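/- arXiv:1201.3842 — 18 statements merged into one kernel-verified Lean document; each statement's English description precedes it below -/
import Mathlib

section
/- Let a and b be positive integers with b even and b > 2a. Then T(a,b;2) ≤ 7b² − 6ab + 13b − 10a; that is, every 2-coloring of {1, 2, ..., 7b² − 6ab + 13b − 10a} contains positive integers x and d such that x, ax + d, and bx + 2d all receive the same color. -/
theorem fin2_ne_imp {u v w : Fin 2} (h : u ≠ v) (hw : w ≠ u) : w = v := by
  revert u v w; decide

/-- If `i` and `i+1` get different colors, a monochromatic triple exists. -/
theorem core (a e N i : ℕ) (χ : ℕ → Fin 2) (he : 0 < e) (hi : 0 < i)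
    (hN : (8*a + 14*e)*(i+1) ≤ N + 2*e)
    (hne : χ i ≠ χ (i+1))
    (H : ∀ x y : ℕ, 0 < x → a*x < y → 2*y + 2*e*x ≤ N → χ y = χ x → χ (2*y+2*e*x) ≠ χ x) :
    False := by
  have red : ∀ y, a*(i+1) < y → 2*y + 2*e*i ≤ N → χ y = χ i → χ (2*y+2*e*i) = χ (i+1) := by
    intro y h1 h2 h3
    exact fin2_ne_imp hne (H i y hi (by nlinarith) h2 h3)
  have blue : ∀ y, a*(i+1) < y → 2*y + 2*e*(i+1) ≤ N → χ y = χ (i+1) →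
      χ (2*y+2*e*(i+1)) = χ i := by
    intro y h1 h2 h3
    exact fin2_ne_imp hne.symm (H (i+1) y (by omega) h1 h2 h3)
  have desc : ∀ n s, a*(i+1) < s → 2*(s+n*e) + 2*e*i ≤ N → χ (s+n*e) = χ i → χ s = χ i := by
    intro n
    induction n with
    | zero => intro s _ _ h; simpa using h
    | succ n ih =>
      intro s h1 h2 h3
      have e1 : s + (n+1)*e = (s+n*e)+e := by ring
      have e2 : 2*(s+n*e) + 2*e*(i+1) = 2*(s+(n+1)*e) + 2*e*i := by ring
      have h4 := red (s+(n+1)*e) (by rw [e1]; omega) h2 h3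
      refine ih s h1 (by rw [e1] at h2; omega) ?_
      refine fin2_ne_imp hne.symm ?_
      intro h5
      have h6 := blue (s+n*e) (by omega) (by rw [e2]; exact h2) h5
      rw [e2, h4] at h6
      exact hne h6.symm
  -- no multiple of `e` in range gets the upper color
  have noblue : ∀ t, a*(i+1) < e*t → 2*(2*(e*t)+2*e*(i+1)) + 2*e*i ≤ N → χ (e*t) = χ i := by
    intro t h1 h2
    refine fin2_ne_imp hne.symm ?_
    intro h3
    have h4 := blue (e*t) h1 (by omega) h3
    have e1 : 2*(e*t)+2*e*(i+1) = e*t + (t+2*(i+1))*e := by ring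
    rw [e1] at h4 h2
    have h5 := desc _ _ h1 h2 h4
    exact hne (h5.symm.trans h3)
  obtain ⟨t, ht1, ht2⟩ : ∃ t, a*(i+1) < e*t ∧ e*t ≤ a*(i+1) + e := by
    refine ⟨a*(i+1)/e + 1, ?_, ?_⟩
    · exact Nat.lt_mul_div_succ _ he
    · have := Nat.mul_div_le (a*(i+1)) e
      rw [mul_add]; omega
  have hb1 : 2*(2*(2*(e*t)+2*e*i)+2*e*(i+1)) + 2*e*i ≤ N := by nlinarith
  have h1 := noblue t ht1 (by nlinarith)
  have h2 := red (e*t) ht1 (by nlinarith) h1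
  have e2 : 2*(e*t)+2*e*i = e*(2*t+2*i) := by ring
  rw [e2] at h2 hb1
  have h3 := noblue (2*t+2*i) (by nlinarith) hb1
  exact hne (h3.symm.trans h2)

theorem stmt_0 (a b : ℕ) (ha : 0 < a) (hb : 0 < b)
    (hpar : Even b) (hord : 2*a < b)
    : (∀ χ : ℕ → Fin 2, ∃ x d : ℕ, 0 < x ∧ 0 < d ∧ b*x + 2*d ≤ 7*b^2 - 6*a*b + 13*b - 10*a ∧ χ (a*x + d) = χ x ∧ χ (b*x + 2*d) = χ x) := by
  intro χ
  by_contra hcon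
  obtain ⟨m, hm⟩ := hpar
  obtain ⟨e, he, rfl⟩ : ∃ e, 0 < e ∧ b = 2*a + 2*e := ⟨m - a, by omega, by omega⟩
  set N := 7*(2*a+2*e)^2 - 6*a*(2*a+2*e) + 13*(2*a+2*e) - 10*a with hNdef
  have hN : N = 28*e^2 + 44*a*e + 16*a^2 + 26*e + 16*a := by
    have h1 : 7*(2*a+2*e)^2 = (28*e^2 + 44*a*e + 16*a^2) + 6*a*(2*a+2*e) := by ring
    rw [hNdef, h1]; omega
  have H : ∀ x y : ℕ, 0 < x → a*x < y → 2*y + 2*e*x ≤ N → χ y = χ x →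
      χ (2*y+2*e*x) ≠ χ x := by
    intro x y hx hy hz h1 h2
    obtain ⟨d, rfl⟩ := Nat.exists_eq_add_of_lt hy
    have e1 : (2*a+2*e)*x + 2*(d+1) = 2*(a*x+d+1) + 2*e*x := by ring
    exact hcon ⟨x, d+1, hx, by omega, by rw [e1]; exact hz, h1, by rw [e1]; exact h2⟩
  by_cases hall : ∃ i, 0 < i ∧ i ≤ 2*a+2*e+1 ∧ χ i ≠ χ (i+1)
  · obtain ⟨i, hi, hib, hne⟩ := hall
    refine core a e N i χ he hi ?_ hne H
    have : (8*a + 14*e)*(i+1) ≤ (8*a+14*e)*(2*a+2*e+2) := Nat.mul_le_mul_left _ (by omega)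
    nlinarith
  · push Not at hall
    have hc : ∀ j, j ≤ 2*a+2*e+1 → χ (j+1) = χ 1 := by
      intro j
      induction j with
      | zero => intro _; rfl
      | succ j ih => intro hj; rw [← hall (j+1) (by omega) hj]; exact ih (by omega)
    have := H 1 (a+1) one_pos (by omega) (by rw [hN]; nlinarith) (hc a (by omega))
    apply this
    have := hc (2*a+2*e+1) le_rfl
    rw [← this]; congr 1; ring
end

section
/- Let a and b be positive integers with b odd and b > 2a. Then T(a,b;2) ≤ 14b² − 12ab + 26b − 20a; that is, every 2-coloring of {1, 2, ..., 14b² − 12ab + 26b − 20a} contains positive integers x and d such that x, ax + d, and bx + 2d all receive the same color. -/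
theorem core_aux (a c N : ℕ) (ha : 0 < a) (hc : Odd c) (p : ℕ → Prop) (h1 : p 1)
    (hN : 8*a*(c+2*a) + 32*a + 22*c + 3*c*(c+2*a) ≤ N)
    (H1 : ∀ x y, 0 < x → a*x < y → 2*y + c*x ≤ N → p x → p y → p (2*y+c*x) → False)
    (H2 : ∀ x y, 0 < x → a*x < y → 2*y + c*x ≤ N → ¬ p x → ¬ p y → ¬ p (2*y+c*x) → False) :
    False := by
  have hc0 : 0 < c := hc.pos
  -- a red to blue change among the odd numbers
  obtain ⟨s, hs, hp, hq⟩ : ∃ s, 2*s+1 ≤ c+2*a+2 ∧ p (2*s+1) ∧ ¬ p (2*s+1+2) := by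
    by_contra hcon
    push Not at hcon
    have hall : ∀ s, 2*s+1 ≤ c+2*a+4 → p (2*s+1) := by
      intro s
      induction s with
      | zero => intro _; simpa using h1
      | succ n ih =>
        intro h
        have := hcon n (by omega) (ih (by omega))
        simpa [mul_add, add_assoc, add_comm, add_left_comm] using this
    obtain ⟨k, hk⟩ := hc
    obtain ⟨t, ht⟩ : ∃ t, 2*t+1 = a+1 ∨ 2*t+1 = a+2 := ⟨(a+1)/2, by omega⟩
    have e : 2*(2*t+1) + c*1 = 2*(2*t+1+k)+1 := by omega
    refine H1 1 (2*t+1) one_pos (by omega) ?_ h1 (hall t (by omega)) ?_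
    · have : 0 ≤ 8*a*(c+2*a) := Nat.zero_le _
      have : 0 ≤ 3*c*(c+2*a) := Nat.zero_le _
      omega
    · rw [e]; exact hall _ (by omega)
  set x := 2*s+1 with hx
  have hx0 : 0 < x := by omega
  -- monotonicity along multiples of c
  have mono : ∀ m, a*(x+2) < c*m → 2*(c*(m+1)) + c*x ≤ N → ¬ p (c*m) → ¬ p (c*(m+1)) := by
    intro m hm hle hb hr
    by_cases hz : p (2*(c*(m+1)) + c*x)
    · exact H1 x (c*(m+1)) hx0 (by nlinarith) hle hp hr hz
    · have e : 2*(c*(m+1)) + c*x = 2*(c*m) + c*(x+2) := by ring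
      rw [e] at hz hle
      exact H2 (x+2) (c*m) (by omega) hm hle hq hb hz
  have mono' : ∀ m j, a*(x+2) < c*m → 2*(c*(m+j)) + c*x ≤ N → ¬ p (c*m) → ¬ p (c*(m+j)) := by
    intro m j hm
    induction j with
    | zero => intro _ h; simpa using h
    | succ n ih =>
      intro hle hb
      exact mono (m+n) (by nlinarith) hle (ih (by nlinarith) hb)
  have red : ∀ m, a*(x+2) < c*m → 4*(c*m) + 3*(c*x) + 4*c ≤ N → p (c*m) := by
    intro m hm hle
    by_contra hb
    have h := mono' m (m+x+2) hm (by nlinarith) hb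
    have e : c*(m+(m+x+2)) = 2*(c*m) + c*(x+2) := by ring
    rw [e] at h
    exact H2 (x+2) (c*m) (by omega) hm (by nlinarith) hq hb h
  obtain ⟨m, hm1, hm2⟩ : ∃ m, a*(x+2) < c*m ∧ c*m ≤ a*(x+2) + c :=
    ⟨a*(x+2)/c+1, Nat.lt_mul_div_succ _ hc0, by
      have := Nat.mul_div_le (a*(x+2)) c
      rw [mul_add]; omega⟩
  have hax : a*(x+2) ≤ a*(c+2*a+4) := Nat.mul_le_mul_left _ (by omega)
  have hcx : c*x ≤ c*(c+2*a+2) := Nat.mul_le_mul_left _ (by omega)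
  have big : 8*(c*m) + 3*(c*x) + 8*c ≤ N := by nlinarith
  have r1 := red m hm1 (by omega)
  have e2 : c*(2*m+1) = 2*(c*m) + c*1 := by ring
  have r2 := red (2*m+1) (by omega) (by omega)
  rw [e2] at r2
  exact H1 1 (c*m) one_pos (by nlinarith) (by omega) h1 r1 r2

theorem stmt_1 (a b : ℕ) (ha : 0 < a) (hb : 0 < b)
    (hpar : Odd b) (hord : 2*a < b)
    : (∀ χ : ℕ → Fin 2, ∃ x d : ℕ, 0 < x ∧ 0 < d ∧ b*x + 2*d ≤ 14*b^2 - 12*a*b + 26*b - 20*a ∧ χ (a*x + d) = χ x ∧ χ (b*x + 2*d) = χ x) := by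
  intro χ
  by_contra hcon
  push Not at hcon
  obtain ⟨c, rfl⟩ : ∃ c, b = c + 2*a := ⟨b - 2*a, by omega⟩
  have hc : Odd c := by
    obtain ⟨k, hk⟩ := hpar
    exact ⟨k - a, by omega⟩
  have hN : 8*a*(c+2*a) + 32*a + 22*c + 3*c*(c+2*a)
      ≤ 14*(c+2*a)^2 - 12*a*(c+2*a) + 26*(c+2*a) - 20*a := by
    have e : 14*(c+2*a)^2 = (14*c+16*a)*(c+2*a) + 12*a*(c+2*a) := by ring
    rw [e, Nat.add_sub_cancel]
    have : (8*a*(c+2*a) + 32*a + 22*c + 3*c*(c+2*a)) + 20*a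
      ≤ (14*c+16*a)*(c+2*a) + 26*(c+2*a) := by nlinarith
    omega
  generalize 14*(c+2*a)^2 - 12*a*(c+2*a) + 26*(c+2*a) - 20*a = N at hcon hN
  have key : ∀ x y, 0 < x → a*x < y → 2*y + c*x ≤ N → χ y = χ x → χ (2*y+c*x) ≠ χ x := by
    intro x y hx hy hle h
    obtain ⟨d, rfl⟩ : ∃ d, y = a*x + d := ⟨y - a*x, by omega⟩
    have e : 2*(a*x+d) + c*x = (c+2*a)*x + 2*d := by ring
    rw [e] at hle ⊢
    exact hcon x d hx (by omega) hle h
  refine core_aux a c N ha hc (fun n => χ n = χ 1) rfl hN ?_ ?_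
  · intro x y hx hy hle p1 p2 p3
    exact key x y hx hy hle (p2.trans p1.symm) (p3.trans p1.symm)
  · intro x y hx hy hle p1 p2 p3
    exact key x y hx hy hle (by omega) (by omega)
end

section
/- Let a and b be positive integers with a ≤ b, b even, and b < 2a. Then T(a,b;2) ≤ 3b² + 2ab + 16a; that is, every 2-coloring of {1, 2, ..., 3b² + 2ab + 16a} contains positive integers x and d such that x, ax + d, and bx + 2d all receive the same color. -/
theorem stmt_2 (a b : ℕ) (ha : 0 < a) (hb : 0 < b)
    (hpar : Even b) (hord : b < 2*a)
    (hab : a ≤ b)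
    : (∀ χ : ℕ → Fin 2, ∃ x d : ℕ, 0 < x ∧ 0 < d ∧ b*x + 2*d ≤ 3*b^2 + 2*a*b + 16*a ∧ χ (a*x + d) = χ x ∧ χ (b*x + 2*d) = χ x) := by
  intro χ
  by_contra hno
  obtain ⟨c, rfl⟩ := hpar
  obtain ⟨e, rfl⟩ : ∃ e, a = c + e := ⟨a - c, by omega⟩
  have he : 0 < e := by omega
  have hec : e ≤ c := by omega
  have hc : 0 < c := by omega
  -- half of the bound
  obtain ⟨n, hn⟩ : ∃ n, n = 8*c^2 + 2*(c*e) + 8*c + 8*e := ⟨_, rfl⟩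
  -- no triple `x`, `w + e x`, `2 w` is monochromatic
  have key : ∀ x w : ℕ, 0 < x → c*x < w → w ≤ n →
      ¬ (χ (w + e*x) = χ x ∧ χ (2*w) = χ x) := by
    intro x w hx hw hwn hh
    apply hno
    refine ⟨x, w - c*x, hx, by omega, ?_, ?_, ?_⟩
    · have : (c + c)*x + 2*(w - c*x) = 2*w := by
        rw [add_mul]; omega
      rw [this]
      calc 2*w ≤ 2*n := by omega
        _ = _ := by rw [hn]; ring
    · have : (c + e)*x + (w - c*x) = w + e*x := by
        rw [add_mul]; omega
      rw [this]; exact hh.1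
    · have : (c + c)*x + 2*(w - c*x) = 2*w := by
        rw [add_mul]; omega
      rw [this]; exact hh.2
  have red : ∀ x w : ℕ, 0 < x → c*x < w → w ≤ n → χ x = χ 1 → χ (w + e*x) = χ 1 →
      χ (2*w) ≠ χ 1 := by
    intro x w hx hw hwn h1 h2 h3
    exact key x w hx hw hwn ⟨h2.trans h1.symm, h3.trans h1.symm⟩
  have blue : ∀ x w : ℕ, 0 < x → c*x < w → w ≤ n → χ x ≠ χ 1 → χ (w + e*x) ≠ χ 1 →
      χ (2*w) = χ 1 := by
    intro x w hx hw hwn h1 h2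
    by_contra h3
    exact key x w hx hw hwn ⟨by omega, by omega⟩
  -- the least element `u = k + 1` of the other colour
  have hex : ∃ u, 0 < u ∧ u ≤ 2*c + 2 ∧ χ u ≠ χ 1 := by
    by_contra hall
    push Not at hall
    refine red 1 (c + 1) (by omega) (by omega) (by nlinarith) rfl ?_ ?_
    · exact hall _ (by omega) (by omega)
    · exact hall _ (by omega) (by omega)
  obtain ⟨k, hk0, hk, hkr, hub⟩ : ∃ k, 0 < k ∧ k + 1 ≤ 2*c + 2 ∧ χ k = χ 1 ∧ χ (k+1) ≠ χ 1 := by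
    classical
    obtain ⟨hu0, hu1, hu2⟩ := Nat.find_spec hex
    have hmin := fun m => Nat.find_min hex (m := m)
    generalize Nat.find hex = u at *
    have hu : u ≠ 1 := by rintro rfl; exact hu2 rfl
    refine ⟨u - 1, by omega, by omega, ?_, ?_⟩
    · by_contra hh
      exact hmin (u - 1) (by omega) ⟨by omega, by omega, hh⟩
    · rwa [Nat.sub_add_cancel hu0]
  obtain ⟨u, hu⟩ : ∃ u, u = k + 1 := ⟨_, rfl⟩
  rw [← hu] at hk hub
  have hu2 : 2 ≤ u := by omega
  have hcu : c*u ≤ 2*c^2 + 2*c := by nlinarith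
  have heu : e*u ≤ c*u := Nat.mul_le_mul_right _ hec
  have heu2 : 2*e ≤ e*u := by nlinarith
  have hcu2 : 2*c ≤ c*u := by nlinarith
  have hek : e*u = e*k + e := by rw [hu]; ring
  have hck : c*u = c*k + c := by rw [hu]; ring
  -- blue even numbers propagate upwards by `2 e`
  have step : ∀ w, c*u < w → w + e ≤ n → χ (2*w) ≠ χ 1 → χ (2*(w+e)) ≠ χ 1 := by
    intro w hw hwn hb hr
    have h1 : χ (w + e + e*k) ≠ χ 1 := fun h =>
      red k (w+e) hk0 (by omega) hwn hkr h hr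
    have h2 : w + e + e*k = w + e*u := by omega
    rw [h2] at h1
    exact hb (blue u w (by omega) hw (by omega) hub h1)
  have steps : ∀ j w, c*u < w → w + e*j ≤ n → χ (2*w) ≠ χ 1 → χ (2*(w+e*j)) ≠ χ 1 := by
    intro j
    induction j with
    | zero => intro w _ _ h; simpa using h
    | succ j ih =>
      intro w hw hwn h
      have e1 : e*(j+1) = e*j + e := by ring
      have := step (w + e*j) (by omega) (by omega) (ih w hw (by omega) h)
      rw [e1, ← add_assoc]; exact this
  -- a multiple `e t` just above `c u`
  obtain ⟨t, ht1, ht2⟩ : ∃ t, c*u < e*t ∧ e*t ≤ c*u + e := by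
    refine ⟨c*u/e + 1, ?_, ?_⟩
    · exact Nat.lt_mul_div_succ _ he
    · rw [mul_add, mul_one]; exact Nat.add_le_add_right (Nat.mul_div_le _ _) _
  have htu : u < t := by
    by_contra hh
    have : e*t ≤ e*u := Nat.mul_le_mul_left _ (by omega)
    omega
  by_cases h0 : χ (2*(e*t)) = χ 1
  · -- red case
    have hb1 : χ (2*(2*(e*t) - e)) ≠ χ 1 := by
      refine red 1 _ one_pos (by omega) (by omega) rfl ?_
      have : 2*(e*t) - e + e*1 = 2*(e*t) := by omega
      rw [this]; exact h0
    -- the element `w = 4 e t - 2 e - e u`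
    have hw : 2*(e*t) - e + e*(2*t - 1 - u) = 4*(e*t) - 2*e - e*u := by
      obtain ⟨s, rfl⟩ : ∃ s, t = u + 1 + s := ⟨t - u - 1, by omega⟩
      have : 2*(u+1+s) - 1 - u = u + 1 + 2*s := by omega
      rw [this]
      have h1 : e*(u+1+s) = e*u + e + e*s := by ring
      have h2 : e*(u+1+2*s) = e*u + e + 2*(e*s) := by ring
      omega
    have hb2 := steps (2*t - 1 - u) (2*(e*t) - e) (by omega) (by omega) hb1
    rw [hw] at hb2
    refine hb2 (blue u _ (by omega) (by omega) (by omega) hub ?_)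
    have : 4*(e*t) - 2*e - e*u + e*u = 2*(2*(e*t) - e) := by omega
    rw [this]; exact hb1
  · -- blue case
    have hw : e*t + e*(t - u) = 2*(e*t) - e*u := by
      obtain ⟨s, rfl⟩ : ∃ s, t = u + s := ⟨t - u, by omega⟩
      have : u + s - u = s := by omega
      rw [this]
      have h1 : e*(u+s) = e*u + e*s := by ring
      omega
    have hb2 := steps (t - u) (e*t) (by omega) (by omega) h0
    rw [hw] at hb2
    refine hb2 (blue u _ (by omega) (by omega) (by omega) hub ?_)
    have : 2*(e*t) - e*u + e*u = 2*(e*t) := by omega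
    rw [this]; exact h0
end

section
/- Let a and b be positive integers with a ≤ b, b odd, and b < 2a. Then T(a,b;2) ≤ 6b² + 4ab + 8b + 16a; that is, every 2-coloring of {1, 2, ..., 6b² + 4ab + 8b + 16a} contains positive integers x and d such that x, ax + d, and bx + 2d all receive the same color. -/
theorem stmt_3 (a b : ℕ) (ha : 0 < a) (hb : 0 < b)
    (hpar : Odd b) (hord : b < 2*a)
    (hab : a ≤ b)
    : (∀ χ : ℕ → Fin 2, ∃ x d : ℕ, 0 < x ∧ 0 < d ∧ b*x + 2*d ≤ 6*b^2 + 4*a*b + 8*b + 16*a ∧ χ (a*x + d) = χ x ∧ χ (b*x + 2*d) = χ x) := by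
  intro χ
  by_contra hcon
  push Not at hcon
  obtain ⟨c, hc⟩ : ∃ c, 2 * a = b + c := ⟨2 * a - b, by omega⟩
  have hc0 : 0 < c := by omega
  have hca : c ≤ a := by omega
  obtain ⟨N, hN⟩ : ∃ N, N = 6*b^2 + 4*a*b + 8*b + 16*a := ⟨_, rfl⟩
  -- basic form of the forbidden triples
  have T : ∀ x y z : ℕ, 0 < x → a * x < y → z + c * x = 2 * y → z ≤ N →
      χ y = χ x → χ z ≠ χ x := by
    intro x y z hx hy hz hzN h1
    have e : 2 * (a * x) = b * x + c * x := by
      rw [← mul_assoc, hc, add_mul]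
    have hd : a * x + (y - a * x) = y := by omega
    have hd2 : b * x + 2 * (y - a * x) = z := by omega
    have := hcon x (y - a * x) hx (by omega) (by rw [hd2, ← hN]; exact hzN)
    rw [hd, hd2] at this
    exact this h1
  have hNb : 4 * b ^ 2 + 16 * b + 8 * c ≤ N := by
    have : 4 * a * b = 2 * b ^ 2 + 2 * (c * b) := by
      have : 4 * a * b = 2 * (2 * a) * b := by ring
      rw [this, hc]; ring
    have h0 := Nat.zero_le (c * b)
    rw [hN, this]
    have h1 := Nat.zero_le (b ^ 2)
    omega
  have hb2 : 0 ≤ b ^ 2 := Nat.zero_le _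
  -- the first odd number of the other color
  have hex : ∃ k, χ (2 * k + 1) ≠ χ 1 ∧ 2 * k + 1 ≤ b + 4 := by
    by_contra hno
    push Not at hno
    obtain ⟨t, ht⟩ := hpar
    have hodd : ∀ m, m % 2 = 1 → m ≤ b + 4 → χ m = χ 1 := by
      intro m hm hm2
      by_contra hne
      have hk : 2 * (m / 2) + 1 = m := by omega
      have := hno (m / 2) (by rw [hk]; exact hne)
      omega
    rcases Nat.mod_two_eq_zero_or_one a with h | h
    · exact T 1 (a + 1) (b + 2) one_pos (by omega) (by omega) (by omega)
        (hodd _ (by omega) (by omega)) (hodd _ (by omega) (by omega))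
    · exact T 1 (a + 2) (b + 4) one_pos (by omega) (by omega) (by omega)
        (hodd _ (by omega) (by omega)) (hodd _ (by omega) (by omega))
  obtain ⟨i, hi0, hij, hjb⟩ : ∃ i, 0 < i ∧ χ (i + 2) ≠ χ i ∧ i + 2 ≤ b + 4 := by
    classical
    have hs := Nat.find_spec hex
    have hm := fun m (h : m < Nat.find hex) => Nat.find_min hex h
    generalize Nat.find hex = k at hs hm
    obtain ⟨h1, h2⟩ := hs
    rcases k with _ | k
    · exact absurd rfl h1
    · refine ⟨2 * k + 1, by omega, ?_, by omega⟩
      have h3 : χ (2 * k + 1) = χ 1 := by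
        by_contra hne
        exact hm k (by omega) ⟨hne, by omega⟩
      rw [h3]
      exact h1
  have two : ∀ u v w : Fin 2, u ≠ w → v ≠ w → u = v := by decide
  have hai : a * (i + 2) = a * i + 2 * a := by ring
  have hci : c * (i + 2) = c * i + 2 * c := by ring
  -- shifting by c preserves the color of i
  have G : ∀ y, a * (i + 2) < y → 2 * y ≤ N → χ y = χ i → χ (y + c) = χ i := by
    intro y hy hyN h
    have hcle : c * i ≤ a * i := Nat.mul_le_mul_right _ hca
    have hz := T i y (2 * y - c * i) hi0 (by omega) (by omega) (by omega) h
    by_contra hne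
    have e1 := two _ _ _ hz hij
    have e2 := two _ _ _ hne hij
    exact T (i + 2) (y + c) (2 * y - c * i) (by omega) (by omega) (by omega) (by omega) e2 e1
  have grow : ∀ n, a * (i + 2) < c * n → χ (c * n) = χ i → ∀ m, 2 * (c * (n + m)) ≤ N →
      χ (c * (n + m)) = χ i := by
    intro n hn h m
    induction m with
    | zero => intro _; exact h
    | succ m ih =>
      intro hm
      have e : c * (n + (m + 1)) = c * (n + m) + c := by ring
      have e0 : c * (n + m) = c * n + c * m := by ring
      have := Nat.zero_le (c * m)
      rw [e] at hm ⊢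
      exact G _ (by omega) (by omega) (ih (by omega))
  -- large multiples of c have the color of i + 2
  have blue : ∀ n, a * (i + 2) < c * n → 4 * (c * n) ≤ N + 2 * (c * i) →
      χ (c * n) ≠ χ i := by
    intro n hn hnN h
    have hlt : c * i < c * n := by
      have : c * i ≤ a * i := Nat.mul_le_mul_right _ hca
      omega
    have hin : i < n := lt_of_mul_lt_mul_left hlt (Nat.zero_le _)
    obtain ⟨m, rfl⟩ : ∃ m, n = i + m := ⟨n - i, by omega⟩
    have e1 : c * (i + m + m) = c * i + 2 * (c * m) := by ring
    have e2 : c * (i + m) = c * i + c * m := by ring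
    have hg := grow (i + m) hn h m (by omega)
    exact T i (c * (i + m)) (c * (i + m + m)) hi0 (by omega) (by omega) (by omega) h hg
  -- choose n
  obtain ⟨n, hn1, hn2⟩ : ∃ n, a * (i + 2) < c * n ∧ c * n ≤ a * (i + 2) + c := by
    refine ⟨a * (i + 2) / c + 1, ?_, ?_⟩
    · exact Nat.lt_mul_div_succ _ hc0
    · rw [mul_add, mul_one]
      exact Nat.add_le_add_right (Nat.mul_div_le _ _) _
  have hlt : c * (i + 2) < c * n := by
    have : c * (i + 2) ≤ a * (i + 2) := Nat.mul_le_mul_right _ hca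
    omega
  have hin : i + 2 < n := lt_of_mul_lt_mul_left hlt (Nat.zero_le _)
  obtain ⟨m, rfl⟩ : ∃ m, n = (i + 2) + m := ⟨n - (i + 2), by omega⟩
  have e1 : c * (i + 2 + m + m) = c * (i + 2) + 2 * (c * m) := by ring
  have e2 : c * (i + 2 + m) = c * (i + 2) + c * m := by ring
  have e3 : 2 * (a * (i + 2)) = b * (i + 2) + c * (i + 2) := by
    rw [← mul_assoc, hc, add_mul]
  have e4 : b * (i + 2) ≤ b ^ 2 + 4 * b := by
    calc b * (i + 2) ≤ b * (b + 4) := Nat.mul_le_mul_left _ hjb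
      _ = b ^ 2 + 4 * b := by ring
  have e5 : c ≤ c * i := Nat.le_mul_of_pos_right _ hi0
  have b1 := blue (i + 2 + m) hn1 (by omega)
  have b2 := blue (i + 2 + m + m) (by omega) (by omega)
  exact T (i + 2) (c * (i + 2 + m)) (c * (i + 2 + m + m)) (by omega) hn1 (by omega) (by omega)
    (two _ _ _ b1 hij) (two _ _ _ b2 hij)
end

section
/- Let a, b, k, M, i be positive integers with a ≤ b, and let χ be a 2-coloring of {1, ..., M} that contains no monochromatic (a,b)-triple and satisfies χ(k) ≠ χ(k+i). Suppose x is a positive integer satisfying: (i) 2x > 2ak + ib; (ii) M ≥ max{x, 2(x − ak) + bk}; (iii) i(b − 2a) is even; and (iv) χ(x) = χ(k). Then χ(x − i(b − 2a)/2) = χ(k). -/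
theorem stmt_4 (a b k M i x : ℤ)
    (ha : 0 < a) (hb : 0 < b) (hk : 0 < k) (hM : 0 < M) (hi : 0 < i) (hx : 0 < x)
    (hab : a ≤ b)
    (χ : ℤ → Fin 2)
    (hvalid : ∀ u d : ℤ, 0 < u → 0 < d → b*u + 2*d ≤ M →
      ¬(χ (a*u + d) = χ u ∧ χ (b*u + 2*d) = χ u))
    (hkM : k + i ≤ M)
    (hne : χ k ≠ χ (k + i))
    (h1 : 2*x > 2*a*k + i*b)
    (h2 : max x (2*(x - a*k) + b*k) ≤ M)
    (h3 : Even (i*(b - 2*a)))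
    (h4 : χ x = χ k) :
    χ (x - i*(b - 2*a)/2) = χ k := by
  obtain ⟨m, hm⟩ := h3
  have hdiv : i*(b - 2*a)/2 = m := by omega
  rw [hdiv]
  have hM2 : 2*(x - a*k) + b*k ≤ M := le_trans (le_max_right _ _) h2
  have hib : 0 < i*b := mul_pos hi hb
  have e1 := hvalid k (x - a*k) hk (by nlinarith) (by linarith)
  have e2 := hvalid (k+i) (x - m - a*(k+i)) (by linarith) (by nlinarith) (by nlinarith)
  have q1 : a*k + (x - a*k) = x := by ring
  have q2 : a*(k+i) + (x - m - a*(k+i)) = x - m := by ring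
  have q3 : b*(k+i) + 2*(x - m - a*(k+i)) = b*k + 2*(x - a*k) := by linarith
  rw [q1] at e1
  rw [q2, q3] at e2
  generalize χ (b*k + 2*(x - a*k)) = z at *
  generalize χ (x - m) = y at *
  generalize χ (k+i) = w at *
  generalize χ k = v at *
  have e3 : z ≠ v := fun h => e1 ⟨h4, h⟩
  clear e1 h4 hvalid
  revert z y w v
  decide
end

section
/- Let a, b, k, M, i be positive integers with a ≤ b, and let χ be a 2-coloring of {1, ..., M} that contains no monochromatic (a,b)-triple and satisfies χ(k) ≠ χ(k+i). Suppose y is a positive integer satisfying: (i) y > b(k + i); (ii) M ≥ max{y, y − i(b − 2a)}; (iii) y and b(k+i) have the same parity; and (iv) χ(y) = χ(k+i). Then χ(y − i(b − 2a)) = χ(k+i). -/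
theorem stmt_5 (a b k M i y : ℤ)
    (ha : 0 < a) (hb : 0 < b) (hk : 0 < k) (hM : 0 < M) (hi : 0 < i) (hy : 0 < y)
    (hab : a ≤ b)
    (χ : ℤ → Fin 2)
    (hvalid : ∀ u d : ℤ, 0 < u → 0 < d → b*u + 2*d ≤ M →
      ¬(χ (a*u + d) = χ u ∧ χ (b*u + 2*d) = χ u))
    (hkM : k + i ≤ M)
    (hne : χ k ≠ χ (k + i))
    (h1 : y > b*(k + i))
    (h2 : max y (y - i*(b - 2*a)) ≤ M)
    (h3 : y % 2 = (b*(k + i)) % 2)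
    (h4 : χ y = χ (k + i)) :
    χ (y - i*(b - 2*a)) = χ (k + i) := by
  obtain ⟨d, hd⟩ : ∃ d, y = b*(k+i) + 2*d := ⟨(y - b*(k+i))/2, by omega⟩
  have hd0 : 0 < d := by linarith
  have hai : 0 < a * i := mul_pos ha hi
  have A := hvalid (k+i) d (by linarith) hd0 (by rw [← hd]; exact le_trans (le_max_left _ _) h2)
  have e : b*k + 2*(d + a*i) = y - i*(b - 2*a) := by rw [hd]; ring
  have B := hvalid k (d + a*i) hk (by linarith) (by rw [e]; exact le_trans (le_max_right _ _) h2)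
  have e2 : a*k + (d + a*i) = a*(k+i) + d := by ring
  rw [e, e2] at B
  rw [← hd] at A
  generalize χ (y - i*(b - 2*a)) = p at *
  generalize χ (a*(k+i) + d) = q at *
  generalize χ y = r at *
  generalize χ (k+i) = s at *
  generalize χ k = t at *
  clear hvalid
  subst h4
  revert A B hne
  clear * -
  revert p q r t
  decide
end

section
/- For every integer a ≥ 4, T(a,a;2) ≥ a² + 3a + 8; equivalently, there exists a 2-coloring of {1, 2, ..., a² + 3a + 7} with no positive integers x, d such that x, ax + d, and ax + 2d all receive the same color. -/
/-- The small cases: a bounded check suffices. -/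
theorem small_case (a N : ℕ) (ha : 0 < a) (χ : ℕ → Fin 2)
    (h : ∀ x ∈ Finset.range (N + 1), ∀ d ∈ Finset.range (N + 1),
      0 < x ∧ 0 < d ∧ a*x + 2*d ≤ N → ¬(χ (a*x + d) = χ x ∧ χ (a*x + 2*d) = χ x)) :
    ∃ χ : ℕ → Fin 2, ∀ x d : ℕ, 0 < x → 0 < d → a*x + 2*d ≤ N →
      ¬(χ (a*x + d) = χ x ∧ χ (a*x + 2*d) = χ x) := by
  refine ⟨χ, ?_⟩
  intro x d hx hd hN
  have h1 : x ≤ a * x := Nat.le_mul_of_pos_left x ha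
  exact h x (Finset.mem_range.2 (by omega)) d (Finset.mem_range.2 (by omega)) ⟨hx, hd, hN⟩

/-- The explicit coloring used for a = 4. -/
def color4 : ℕ → Fin 2 :=
  fun n => if n ≤ 5 ∨ n = 7 ∨ n = 8 ∨ (25 ≤ n ∧ n ≤ 29) then 0 else 1

/-- The explicit coloring used for a = 5. -/
def color5 : ℕ → Fin 2 :=
  fun n => if n ≤ 6 ∨ (37 ≤ n ∧ n ≤ 43) ∨ n = 47 then 0 else 1

theorem stmt_6 (a : ℕ) (ha : 4 ≤ a) :
    (∃ χ : ℕ → Fin 2, ∀ x d : ℕ, 0 < x → 0 < d → a*x + 2*d ≤ a^2 + 3*a + 7 → ¬(χ (a*x + d) = χ x ∧ χ (a*x + 2*d) = χ x)) := by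
  rcases (by omega : a = 4 ∨ a = 5 ∨ 6 ≤ a) with rfl | rfl | h6
  · refine small_case 4 (4^2 + 3*4 + 7) (by norm_num)
      color4 ?_
    decide +kernel
  · refine small_case 5 (5^2 + 3*5 + 7) (by norm_num)
      color5 ?_
    decide +kernel
  · refine ⟨fun n => if n ≤ a + 1 ∨ (a^2 + 2*a + 2 ≤ n ∧ n ≤ a^2 + 3*a + 3) then 0 else 1, ?_⟩
    intro x d hx hd hN
    have hsq : a * a = a^2 := by ring
    have hbig : 6 * a ≤ a^2 := by nlinarith
    have hlow : a ≤ a * x := Nat.le_mul_of_pos_right a hx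
    rintro ⟨h1, h2⟩
    have e1 : x ≤ a + 1 → a * x ≤ a^2 + a := fun h => by nlinarith
    have e2 : a + 2 ≤ x → a^2 + 2*a ≤ a * x := fun h => by nlinarith
    have e3 : x ≤ a + 3 → a * x ≤ a^2 + 3*a := fun h => by nlinarith
    have e4 : a + 4 ≤ x → a^2 + 4*a ≤ a * x := fun h => by nlinarith
    have hx4 : x ≤ a + 3 := by
      by_contra hc
      have := e4 (by omega)
      omega
    have e5 := e3 hx4
    generalize a * x = m at *
    generalize a^2 = s at *
    by_cases hxa : x ≤ a + 1
    · have := e1 hxa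
      simp only [hxa, true_or, if_true] at h1 h2
      split_ifs at h1 h2 <;> first | omega | simp_all
    · have := e2 (by omega)
      have hr : ¬ (x ≤ a + 1 ∨ (s + 2*a + 2 ≤ x ∧ x ≤ s + 3*a + 3)) := by omega
      simp only [hr, if_false] at h1 h2
      split_ifs at h1 h2 <;> first | omega | simp_all
end

section
/- For every integer a > 1, T(a,a;3) ≥ 3a³ + 4a² + 5a + 8; equivalently, there exists a 3-coloring of {1, 2, ..., 3a³ + 4a² + 5a + 7} with no positive integers x, d such that x, ax + d, and ax + 2d all receive the same color. -/
/-- Five consecutive blocks with colors 0, 1, 2, 0, 1. -/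
def blockColor (a x : ℕ) : Fin 3 :=
  if x ≤ a + 1 then 0
  else if x ≤ a^2 + 2*a + 1 then 1
  else if x ≤ a^3 + 2*a^2 + 2*a + 1 then 2
  else if x ≤ 2*a^3 + 3*a^2 + 3*a + 3 then 0
  else 1

theorem stmt_7 (a : ℕ) (ha : 1 < a) :
    (∃ χ : ℕ → Fin 3, ∀ x d : ℕ, 0 < x → 0 < d → a*x + 2*d ≤ 3*a^3 + 4*a^2 + 5*a + 7 → ¬(χ (a*x + d) = χ x ∧ χ (a*x + 2*d) = χ x)) := by
  refine ⟨blockColor a, ?_⟩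
  rintro x d hx hd hN ⟨h1, h2⟩
  have e0 : a ≤ a * x := Nat.le_mul_of_pos_right a hx
  have e1 : x ≤ a + 1 → a * x ≤ a^2 + a := fun h => by nlinarith
  have e2 : x ≤ a^2 + 2*a + 1 → a * x ≤ a^3 + 2*a^2 + a := fun h => by
    have := Nat.mul_le_mul_left a h
    nlinarith
  have f1 : ¬ x ≤ a + 1 → a^2 + 2*a ≤ a * x := fun h => by
    have := Nat.mul_le_mul_left a (show a + 2 ≤ x by omega)
    nlinarith
  have f2 : ¬ x ≤ a^2 + 2*a + 1 → a^3 + 2*a^2 + 2*a ≤ a * x := fun h => by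
    have := Nat.mul_le_mul_left a (show a^2 + 2*a + 2 ≤ x by omega)
    nlinarith
  have f3 : 2 * x ≤ a * x := Nat.mul_le_mul_right x ha
  have p2 : 2 * a ≤ a^2 := by nlinarith
  have p3 : 2 * a^2 ≤ a^3 := by
    have := Nat.mul_le_mul_right (a^2) ha
    nlinarith
  unfold blockColor at h1 h2
  generalize a * x = w at *
  generalize a^3 = q at *
  split_ifs at h1 h2 <;> first | omega | (exfalso; revert h1; decide) | (exfalso; revert h2; decide)
end

section
/- For every integer a > 1, T(a,a;4) ≥ 7a⁴ + 12a³ + 6a² + 9a + 16; equivalently, there exists a 4-coloring of {1, 2, ..., 7a⁴ + 12a³ + 6a² + 9a + 15} with no positive integers x, d such that x, ax + d, and ax + 2d all receive the same color. -/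
/-- The interval coloring with breakpoints `m1 ≤ ... ≤ m6`. -/
def ivColor (m1 m2 m3 m4 m5 m6 n : ℕ) : Fin 4 :=
  if n ≤ m1 then 0 else if n ≤ m2 then 1 else if n ≤ m3 then 2 else if n ≤ m4 then 3
  else if n ≤ m5 then 0 else if n ≤ m6 then 1 else 2

theorem ivColor_spec (m1 m2 m3 m4 m5 m6 n : ℕ) :
    (ivColor m1 m2 m3 m4 m5 m6 n = 0 ∧ (n ≤ m1 ∨ (m4 < n ∧ n ≤ m5))) ∨
    (ivColor m1 m2 m3 m4 m5 m6 n = 1 ∧ ((m1 < n ∧ n ≤ m2) ∨ (m5 < n ∧ n ≤ m6))) ∨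
    (ivColor m1 m2 m3 m4 m5 m6 n = 2 ∧ ((m2 < n ∧ n ≤ m3) ∨ m6 < n)) ∨
    (ivColor m1 m2 m3 m4 m5 m6 n = 3 ∧ (m3 < n ∧ n ≤ m4)) := by
  unfold ivColor
  split_ifs <;> simp <;> omega

theorem stmt_8 (a : ℕ) (ha : 1 < a) :
    (∃ χ : ℕ → Fin 4, ∀ x d : ℕ, 0 < x → 0 < d → a*x + 2*d ≤ 7*a^4 + 12*a^3 + 6*a^2 + 9*a + 15 → ¬(χ (a*x + d) = χ x ∧ χ (a*x + 2*d) = χ x)) := by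
  obtain ⟨m1, h1⟩ : ∃ m, m = a + 1 := ⟨_, rfl⟩
  obtain ⟨m2, h2⟩ : ∃ m, m = a * m1 + a + 1 := ⟨_, rfl⟩
  obtain ⟨m3, h3⟩ : ∃ m, m = a * m2 + a + 1 := ⟨_, rfl⟩
  obtain ⟨m4, h4⟩ : ∃ m, m = a * m3 + a + 1 := ⟨_, rfl⟩
  have l12 : a * m1 ≤ a * m2 := Nat.mul_le_mul_left a (by nlinarith)
  have l23 : a * m2 ≤ a * m3 := Nat.mul_le_mul_left a (by omega)
  obtain ⟨m5, h5⟩ : ∃ m, m + a * m1 = 2 * m4 + 1 := ⟨2 * m4 + 1 - a * m1, by omega⟩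
  obtain ⟨m6, h6⟩ : ∃ m, m + a * m2 = 2 * m5 + 1 := ⟨2 * m5 + 1 - a * m2, by omega⟩
  obtain ⟨m7, h7⟩ : ∃ m, m + a * m3 = 2 * m6 + 1 := ⟨2 * m6 + 1 - a * m3, by omega⟩
  have hN : 7*a^4 + 12*a^3 + 6*a^2 + 9*a + 15 = m7 := by
    have e : m7 + a * m3 + 2 * (a * m2) + 4 * (a * m1) = 8 * m4 + 7 := by omega
    subst h4 h3 h2 h1
    ring_nf at e ⊢
    omega
  refine ⟨ivColor m1 m2 m3 m4 m5 m6, ?_⟩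
  intro x d hx hd hle
  rw [hN] at hle
  have up : ∀ m, x ≤ m → a * x ≤ a * m := fun m h => Nat.mul_le_mul_left a h
  have lo : ∀ m, m < x → a * m + a ≤ a * x := fun m h => by
    have := Nat.mul_le_mul_left a (Nat.succ_le_of_lt h)
    rwa [Nat.mul_succ] at this
  have u1 := up m1
  have u2 := up m2
  have u3 := up m3
  have g1 := lo m1
  have g2 := lo m2
  have g3 := lo m3
  have g0 := lo 0 hx
  have gx : 2 * x ≤ a * x := Nat.mul_le_mul_right x ha
  clear hN up lo
  rintro ⟨hy, hz⟩
  have sx := ivColor_spec m1 m2 m3 m4 m5 m6 x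
  have sy := ivColor_spec m1 m2 m3 m4 m5 m6 (a * x + d)
  have sz := ivColor_spec m1 m2 m3 m4 m5 m6 (a * x + 2 * d)
  rw [hy] at sy
  rw [hz] at sz
  generalize ivColor m1 m2 m3 m4 m5 m6 x = c at sx sy sz
  clear hy hz
  generalize a * x = p at *
  generalize a * m1 = p1 at *
  generalize a * m2 = p2 at *
  generalize a * m3 = p3 at *
  fin_cases c <;> simp at sx sy sz <;> omega
end

section
/- Let a and b be positive integers with b > 2a. Then 2b² + 5b − 2a + 4 ≤ T(a,b;2) ≤ 4a(b³ + b² − 3b − 3) + 2b³ + 4b² + 6b. That is, every 2-coloring of {1, ..., 4a(b³ + b² − 3b − 3) + 2b³ + 4b² + 6b} contains a monochromatic (a,b)-triple, and there exists a 2-coloring of {1, ..., 2b² + 5b − 2a + 3} with no monochromatic (a,b)-triple. -/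
lemma fin2_eq {p q r : Fin 2} (h1 : p ≠ q) (h2 : r ≠ q) : p = r := by omega

lemma bound_aux (a c : ℕ) (ha : 0 < a) (hc : 0 < c) :
    4*a*(2*(2*a+c)^2+4*(2*a+c)+4) + 4*c + 2*c*(2*a+c+2) + c*(2*(2*a+c)^2+4*(2*a+c)+4)
      ≤ 4*a*((2*a+c)^3 + (2*a+c)^2 - 3*(2*a+c) - 3) + 2*(2*a+c)^3 + 4*(2*a+c)^2 + 6*(2*a+c) := by
  obtain ⟨p, rfl⟩ : ∃ p, a = p + 1 := ⟨a - 1, by omega⟩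
  obtain ⟨q, rfl⟩ : ∃ q, c = q + 1 := ⟨c - 1, by omega⟩
  obtain ⟨s, hs⟩ : ∃ s, (2*(p+1)+(q+1))^3 + (2*(p+1)+(q+1))^2 = s + 3*(2*(p+1)+(q+1)) + 3 := by
    refine ⟨(2*(p+1)+(q+1))^3 + (2*(p+1)+(q+1))^2 - 3*(2*(p+1)+(q+1)) - 3, ?_⟩
    have : 3*(2*(p+1)+(q+1)) + 3 ≤ (2*(p+1)+(q+1))^3 + (2*(p+1)+(q+1))^2 := by
      have h3 : 3 ≤ 2*(p+1)+(q+1) := by omega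
      generalize 2*(p+1)+(q+1) = b at *
      have h4 : 3 * b ≤ b^2 := by nlinarith
      have h5 : 9 * b ≤ b^3 := by nlinarith
      omega
    omega
  have e : (2*(p+1)+(q+1))^3 + (2*(p+1)+(q+1))^2 - 3*(2*(p+1)+(q+1)) - 3 = s := by omega
  rw [e]
  zify at hs ⊢
  have hs' : (s : ℤ) = (2*(p+1)+(q+1))^3 + (2*(p+1)+(q+1))^2 - 3*(2*(p+1)+(q+1)) - 3 := by linarith
  rw [hs', ← sub_nonneg]
  ring_nf
  positivity

lemma upper_aux (a c M : ℕ) (χ : ℕ → Fin 2) (ha : 0 < a) (hc : 0 < c)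
    (hM : 4*a*(2*(2*a+c)^2+4*(2*a+c)+4) + 4*c + 2*c*(2*a+c+2)
      + c*(2*(2*a+c)^2+4*(2*a+c)+4) ≤ M)
    (H : ∀ x y, 0 < x → a*x < y → 2*y + c*x ≤ M → χ y = χ x → χ (2*y+c*x) ≠ χ x) : False := by
  obtain ⟨X, hX⟩ : ∃ X, X = 2*(2*a+c)^2+4*(2*a+c)+4 := ⟨_, rfl⟩
  rw [← hX] at hM
  have hXM : 2 * X ≤ M := by nlinarith [Nat.zero_le (c*X), Nat.zero_le (c*(2*a+c+2))]
  have hbX : 2 * (2*a+c+2) ≤ X := by rw [hX]; nlinarith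
  -- every colour has a switch point
  have S : ∀ col : Fin 2, ∃ x, 0 < x ∧ x + 2 ≤ X ∧ χ x = col ∧ χ (x+2) ≠ col := by
    intro col
    by_contra! hS
    obtain ⟨j, hj0, hj, hjc⟩ : ∃ j, 0 < j ∧ j ≤ 2*a+c+2 ∧ χ (2*j) = col := by
      by_contra! hE
      have e1 := hE 1 (by omega) (by omega)
      have e2 := hE (a+1) (by omega) (by omega)
      have e3 := hE (2*a+c+2) (by omega) (by omega)
      have e : 2*(2*(a+1)) + c*(2*1) = 2*(2*a+c+2) := by ring
      have := H (2*1) (2*(a+1)) (by omega) (by omega) (by omega) (fin2_eq e2 e1)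
      rw [e] at this
      exact this (fin2_eq e3 e1)
    have I : ∀ i, 2*j + 2*i ≤ X → χ (2*j+2*i) = col := by
      intro i
      induction i with
      | zero => intro _; simpa using hjc
      | succ n ih =>
        intro h
        exact hS (2*j+2*n) (by omega) (by omega) (ih (by omega))
    obtain ⟨p, rfl⟩ : ∃ p, a = p + 1 := ⟨a - 1, by omega⟩
    have hz : (2*(p+1)+c)*(2*j)+4 ≤ X := by rw [hX]; nlinarith
    have ey : 2*j + 2*(p*j+1) = (p+1)*(2*j)+2 := by ring
    have ez : 2*((p+1)*(2*j)+2) + c*(2*j) = (2*(p+1)+c)*(2*j)+4 := by ring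
    have ez' : 2*j + 2*((2*p+1+c)*j+2) = (2*(p+1)+c)*(2*j)+4 := by ring
    have hy := I (p*j+1) (by rw [ey]; omega)
    have hz' := I ((2*p+1+c)*j+2) (by rw [ez']; exact hz)
    rw [ey] at hy
    rw [ez', ← ez] at hz'
    exact H (2*j) ((p+1)*(2*j)+2) (by omega) (by omega) (by omega) (hy.trans hjc.symm)
      (hz'.trans hjc.symm)
  -- every colour has a small element
  have E : ∀ col : Fin 2, ∃ x, 0 < x ∧ x ≤ 2*a+c+2 ∧ χ x = col := by
    intro col
    by_contra! hE
    have e1 := hE 1 (by omega) (by omega)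
    have e2 := hE (a+1) (by omega) (by omega)
    have e3 := hE (2*a+c+2) (by omega) (by omega)
    have e : 2*(a+1) + c*1 = 2*a+c+2 := by ring
    have := H 1 (a+1) (by omega) (by omega) (by omega) (fin2_eq e2 e1)
    rw [e] at this
    exact this (fin2_eq e3 e1)
  -- periodicity
  have P : ∀ y, a*X < y → 2*(y+c) + c*X ≤ M → χ y = χ (y+c) := by
    intro y hy hyM
    obtain ⟨x, hx0, hxX, hx, hx2⟩ := S (χ (y+c))
    have m1 : a*(x+2) ≤ a*X := Nat.mul_le_mul_left _ hxX
    have m2 : a*x ≤ a*X := Nat.mul_le_mul_left _ (by omega)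
    have m3 : c*x ≤ c*X := Nat.mul_le_mul_left _ (by omega)
    have h1 := H x (y+c) hx0 (by omega) (by omega) hx.symm
    have e : 2*(y+c) + c*x = 2*y + c*(x+2) := by ring
    rw [e, hx] at h1
    by_contra hne
    have h2 := H (x+2) y (by omega) (by omega) (by omega) (fin2_eq hne hx2)
    exact h2 (fin2_eq h1 hx2)
  obtain ⟨m, hm1, hm2⟩ : ∃ m, a*X < m*c ∧ m*c ≤ a*X + c := by
    refine ⟨a*X/c+1, ?_, ?_⟩
    · have := Nat.lt_div_mul_add hc (a := a*X)
      rw [add_mul]; omega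
    · have := Nat.div_mul_le_self (a*X) c
      rw [add_mul]; omega
  obtain ⟨x, hx0, hxb, hx⟩ := E (χ (m*c))
  have hcx : c*x ≤ c*(2*a+c+2) := Nat.mul_le_mul_left _ hxb
  have hM' : 4*(a*X) + 4*c + 2*(c*(2*a+c+2)) + c*X ≤ M := by
    have : 4*a*X + 4*c + 2*c*(2*a+c+2) + c*X = 4*(a*X) + 4*c + 2*(c*(2*a+c+2)) + c*X := by ring
    omega
  have W : ∀ i, i ≤ m + x → χ (m*c + i*c) = χ (m*c) := by
    intro i
    induction i with
    | zero => intro _; simp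
    | succ n ih =>
      intro h
      have k : (n+1)*c ≤ (m+x)*c := Nat.mul_le_mul_right _ h
      have k2 : (m+x)*c = m*c + c*x := by ring
      have k3 : (n+1)*c = n*c + c := by ring
      have := P (m*c+n*c) (by omega) (by omega)
      rw [k3, ← add_assoc, ← this]
      exact ih (by omega)
  have hz := W (m+x) le_rfl
  have e : m*c + (m+x)*c = 2*(m*c) + c*x := by ring
  rw [e] at hz
  have hxX : a*x ≤ a*X := Nat.mul_le_mul_left _ (by omega)
  exact H x (m*c) hx0 (by omega) (by omega) hx.symm (hz.trans hx.symm)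

theorem stmt_9 (a b : ℕ) (ha : 0 < a) (hb : 0 < b) (hord : 2*a < b) :
    (∀ χ : ℕ → Fin 2, ∃ x d : ℕ, 0 < x ∧ 0 < d ∧ b*x + 2*d ≤ 4*a*(b^3 + b^2 - 3*b - 3) + 2*b^3 + 4*b^2 + 6*b ∧ χ (a*x + d) = χ x ∧ χ (b*x + 2*d) = χ x) ∧
    (∃ χ : ℕ → Fin 2, ∀ x d : ℕ, 0 < x → 0 < d → b*x + 2*d ≤ 2*b^2 + 5*b - 2*a + 3 → ¬(χ (a*x + d) = χ x ∧ χ (b*x + 2*d) = χ x)) := by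
  obtain ⟨c, rfl⟩ : ∃ c, b = 2*a + c := ⟨b - 2*a, by omega⟩
  have hc : 0 < c := by omega
  constructor
  · intro χ
    by_contra! hno
    refine upper_aux a c _ χ ha hc (bound_aux a c ha hc) ?_
    intro x y hx hy hz hxy
    obtain ⟨d, rfl⟩ : ∃ d, y = a*x + d := ⟨y - a*x, by omega⟩
    have e : 2*(a*x+d) + c*x = (2*a+c)*x + 2*d := by ring
    rw [e] at hz ⊢
    exact hno x d hx (by omega) hz hxy
  · obtain ⟨b, hbd⟩ : ∃ b, b = 2*a+c := ⟨_, rfl⟩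
    rw [← hbd]
    refine ⟨fun n => if b + 2 ≤ n ∧ n ≤ b^2 + 2*b + 1 then 1 else 0, ?_⟩
    intro x d hx hd hle hmono
    have hb3 : 3 ≤ b := by omega
    have hle' : b*x + 2*d + 2*a ≤ 2*b^2 + 5*b + 3 := by omega
    have ez : b*x + 2*d = 2*(a*x+d) + c*x := by rw [hbd]; ring
    have hax : x ≤ a*x := Nat.le_mul_of_pos_left _ ha
    have hcx : c ≤ c*x := Nat.le_mul_of_pos_right _ hx
    have hbx : b ≤ b*x := Nat.le_mul_of_pos_right _ hx
    obtain ⟨h1, h2⟩ := hmono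
    dsimp only at h1 h2
    by_cases hxB : b + 2 ≤ x ∧ x ≤ b^2 + 2*b + 1
    · rw [if_pos hxB] at h1 h2
      have : b*(b+2) ≤ b*x := Nat.mul_le_mul_left _ hxB.1
      have e : b*(b+2) = b^2+2*b := by ring
      split_ifs at h2 with hz
      · omega
      · simp at h2
    · rw [if_neg hxB] at h1 h2
      have hyN : ¬ (b + 2 ≤ a*x+d ∧ a*x+d ≤ b^2+2*b+1) := by
        intro h; rw [if_pos h] at h1; simp at h1
      have hzN : ¬ (b + 2 ≤ b*x+2*d ∧ b*x+2*d ≤ b^2+2*b+1) := by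
        intro h; rw [if_pos h] at h2; simp at h2
      have hy : a*x+d ≤ b+1 := by omega
      have hx' : x ≤ b+1 := by omega
      have k : c*x ≤ c*(b+1) := Nat.mul_le_mul_left _ hx'
      have k2 : c*(b+1) + 2*(b+1) ≤ b*(b+1) := by
        rw [← add_mul]; exact Nat.mul_le_mul_right _ (by omega)
      have e : b*(b+1) = b^2+b := by ring
      omega
end

section
/- Let a be a positive integer and let b = 2a. Then for every positive integer n there exists a 2-coloring of {1, 2, ..., n} with no positive integers x, d such that x, ax + d, and 2ax + 2d all receive the same color; in particular, T(a,2a;2) does not exist. -/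
theorem stmt_11 (a : ℕ) (ha : 0 < a) :
    ∀ n : ℕ, ∃ χ : ℕ → Fin 2, ∀ x d : ℕ, 0 < x → 0 < d → 2*a*x + 2*d ≤ n →
      ¬(χ (a*x + d) = χ x ∧ χ (2*a*x + 2*d) = χ x) := by
  intro n
  refine ⟨fun m => if Even (padicValNat 2 m) then 0 else 1, ?_⟩
  rintro x d hx hd - ⟨h1, h2⟩
  have h3 := h1.trans h2.symm
  have e : 2*a*x + 2*d = 2 * (a*x + d) := by ring
  have hy : a*x + d ≠ 0 := by omega
  have v : padicValNat 2 (2 * (a*x + d)) = padicValNat 2 (a*x + d) + 1 := by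
    rw [padicValNat.mul (by norm_num) hy, padicValNat_self, add_comm]
  simp only [e, v, Nat.even_add_one] at h3
  by_cases h : Even (padicValNat 2 (a*x + d)) <;> simp [h] at h3
end

section
/- T(1,6;2) = 108; that is, 108 is the least positive integer n such that every 2-coloring of {1,...,n} contains positive integers x, d with x, x + d, and 6x + 2d all the same color: every 2-coloring of {1,...,108} contains such a monochromatic triple, and some 2-coloring of {1,...,107} contains none. -/
/-- The relative color `p n` (whether `n` has the color of `1`) cannot avoid all triples. -/
theorem no_good (p : ℕ → Bool) (h1 : p 1 = true)
    (H : ∀ x d : ℕ, 0 < x → 0 < d → 6*x + 2*d ≤ 108 →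
      ¬(p (x + d) = p x ∧ p (6*x + 2*d) = p x)) : False := by
  have H8 : p 8 = true := by
    by_contra h
    have h8 : p 8 = false := by simpa using h
    have h3 : p 3 = true := by
      by_contra h
      have h3 : p 3 = false := by simpa using h
      have h28 : p 28 = true := by
        simpa [h3, h8] using H 3 5 (by decide) (by decide) (by decide)
      have h60 : p 60 = false := by
        simpa [h1, h28] using H 1 27 (by decide) (by decide) (by decide)
      have h14 : p 14 = true := by
        simpa [h8, h60] using H 8 6 (by decide) (by decide) (by decide)
      have h5 : p 5 = false := by
        simpa [h1, h14] using H 1 4 (by decide) (by decide) (by decide)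
      have h12 : p 12 = false := by
        simpa [h1, h28] using H 1 11 (by decide) (by decide) (by decide)
      have h36 : p 36 = true := by
        simpa [h3, h12] using H 3 9 (by decide) (by decide) (by decide)
      have h16 : p 16 = false := by
        simpa [h1, h36] using H 1 15 (by decide) (by decide) (by decide)
      have h24 : p 24 = true := by
        simpa [h3, h60] using H 3 21 (by decide) (by decide) (by decide)
      have h52 : p 52 = false := by
        simpa [h1, h24] using H 1 23 (by decide) (by decide) (by decide)
      simpa [h5, h16, h52] using H 5 11 (by decide) (by decide) (by decide)
    have h10 : p 10 = false := by
      simpa [h1, h3] using H 1 2 (by decide) (by decide) (by decide)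
    have h52 : p 52 = true := by
      simpa [h8, h10] using H 8 2 (by decide) (by decide) (by decide)
    have h20 : p 20 = false := by
      simpa [h3, h52] using H 3 17 (by decide) (by decide) (by decide)
    have h80 : p 80 = true := by
      simpa [h10, h20] using H 10 10 (by decide) (by decide) (by decide)
    have h38 : p 38 = false := by
      simpa [h1, h80] using H 1 37 (by decide) (by decide) (by decide)
    have h108 : p 108 = false := by
      simpa [h1, h52] using H 1 51 (by decide) (by decide) (by decide)
    simpa [h8, h38, h108] using H 8 30 (by decide) (by decide) (by decide)
  have h8 := H8
  have h2 : p 2 = false := by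
    simpa [h1, h8] using H 1 1 (by decide) (by decide) (by decide)
  have h20 : p 20 = false := by
    simpa [h1, h8] using H 1 7 (by decide) (by decide) (by decide)
  have h6 : p 6 = true := by
    simpa [h2, h20] using H 2 4 (by decide) (by decide) (by decide)
  have h16 : p 16 = false := by
    simpa [h1, h6] using H 1 5 (by decide) (by decide) (by decide)
  have h40 : p 40 = false := by
    simpa [h6, h8] using H 6 2 (by decide) (by decide) (by decide)
  simpa [h2, h16, h40] using H 2 14 (by decide) (by decide) (by decide)

def badSet : List ℕ := [8, 10, 12, 14, 16, 18, 20, 22, 24, 26, 28, 30, 32, 34, 36, 38, 40, 42, 44, 46, 48, 50, 54, 58, 62, 66, 70, 74, 78, 82, 86, 90, 94, 98, 102, 106]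

def badColor (n : ℕ) : Bool := badSet.contains n

/-- The pair `(x, d)` is out of range, or its triple is not monochromatic. -/
def goodPair (x d : ℕ) : Bool :=
  x == 0 || d == 0 || Nat.blt 107 (6*x + 2*d) ||
    !(badColor (x + d) == badColor x && badColor (6*x + 2*d) == badColor x)

theorem stmt_12 :
    (∀ χ : ℕ → Fin 2, ∃ x d : ℕ, 0 < x ∧ 0 < d ∧ 6*x + 2*d ≤ 108 ∧ χ (x + d) = χ x ∧ χ (6*x + 2*d) = χ x) ∧
    (∃ χ : ℕ → Fin 2, ∀ x d : ℕ, 0 < x → 0 < d → 6*x + 2*d ≤ 107 → ¬(χ (x + d) = χ x ∧ χ (6*x + 2*d) = χ x)) := by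
  constructor
  · intro χ
    by_contra hc
    push Not at hc
    refine no_good (fun n => decide (χ n = χ 1)) (by simp) ?_
    rintro x d hx hd hle ⟨ha, hb⟩
    have key : ∀ a b c : Fin 2, decide (a = c) = decide (b = c) → a = b := by decide
    exact hc x d hx hd hle (key _ _ _ ha) (key _ _ _ hb)
  · refine ⟨fun n => if badColor n then 1 else 0, ?_⟩
    have key : ∀ x : Fin 18, ∀ d : Fin 54, goodPair x d = true := by
      decide +kernel
    rintro x d hx hd hle ⟨ha, hb⟩
    have conv : ∀ a b : Bool, (if a then (1 : Fin 2) else 0) = (if b then 1 else 0) → a = b := by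
      decide
    have hk := key ⟨x, by omega⟩ ⟨d, by omega⟩
    have h1 := conv _ _ ha
    have h2 := conv _ _ hb
    simp [goodPair, h1, h2] at hk
    omega
end

section
/- T(1,7;2) = 139; that is, 139 is the least positive integer n such that every 2-coloring of {1,...,n} contains positive integers x, d with x, x + d, and 7x + 2d all the same color: every 2-coloring of {1,...,139} contains such a monochromatic triple, and some 2-coloring of {1,...,138} contains none. -/
theorem upper_aux_s13 (A : ℕ → Prop) (h1 : A 1)
    (H1 : ∀ x d : ℕ, 0 < x → 0 < d → 7*x + 2*d ≤ 139 → A x → A (x + d) → A (7*x + 2*d) → False)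
    (H0 : ∀ x d : ℕ, 0 < x → 0 < d → 7*x + 2*d ≤ 139 → ¬ A x → ¬ A (x + d) → ¬ A (7*x + 2*d) → False) :
    False := by
  have h15 : ¬ A 15 := by
    intro h15
    have h5 : ¬ A 5 := fun h => H1 1 4 (by decide) (by decide) (by decide) h1 h h15
    have h35 : ¬ A 35 := fun h => H1 1 14 (by decide) (by decide) (by decide) h1 h15 h
    have h95 : A 95 := by_contra fun h => H0 5 30 (by decide) (by decide) (by decide) h5 h35 h
    have h45 : ¬ A 45 := fun h => H1 1 44 (by decide) (by decide) (by decide) h1 h h95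
    have h115 : A 115 := by_contra fun h => H0 5 40 (by decide) (by decide) (by decide) h5 h45 h
    have h20 : ¬ A 20 := fun h => H1 15 5 (by decide) (by decide) (by decide) h15 h h115
    have h13 : ¬ A 13 := fun h => H1 13 2 (by decide) (by decide) (by decide) h h15 h95
    have h135 : A 135 := by_contra fun h => H0 13 22 (by decide) (by decide) (by decide) h13 h35 h
    have h65 : ¬ A 65 := fun h => H1 1 64 (by decide) (by decide) (by decide) h1 h h135
    exact H0 5 15 (by decide) (by decide) (by decide) h5 h20 h65
  by_cases h2 : A 2
  · have h9 : ¬ A 9 := fun h => H1 1 1 (by decide) (by decide) (by decide) h1 h2 h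
    have h75 : A 75 := by_contra fun h => H0 9 6 (by decide) (by decide) (by decide) h9 h15 h
    have h35 : ¬ A 35 := fun h => H1 1 34 (by decide) (by decide) (by decide) h1 h h75
    have h115 : A 115 := by_contra fun h => H0 9 26 (by decide) (by decide) (by decide) h9 h35 h
    have h55 : ¬ A 55 := fun h => H1 1 54 (by decide) (by decide) (by decide) h1 h h115
    have h5 : A 5 := by_contra fun h => H0 5 10 (by decide) (by decide) (by decide) h h15 h55
    have h20 : ¬ A 20 := fun h => H1 2 3 (by decide) (by decide) (by decide) h2 h5 h
    have h3 : A 3 := by_contra fun h => H0 3 17 (by decide) (by decide) (by decide) h h20 h55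
    have h50 : ¬ A 50 := fun h => H1 3 47 (by decide) (by decide) (by decide) h3 h h115
    have h4 : A 4 := by_contra fun h => H0 4 11 (by decide) (by decide) (by decide) h h15 h50
    have h13 : ¬ A 13 := fun h => H1 1 3 (by decide) (by decide) (by decide) h1 h4 h
    have h45 : ¬ A 45 := fun h => H1 5 40 (by decide) (by decide) (by decide) h5 h h115
    have h135 : A 135 := by_contra fun h => H0 9 36 (by decide) (by decide) (by decide) h9 h45 h
    have h60 : ¬ A 60 := fun h => H1 3 57 (by decide) (by decide) (by decide) h3 h h135
    have h6 : A 6 := by_contra fun h => H0 6 9 (by decide) (by decide) (by decide) h h15 h60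
    have h37 : ¬ A 37 := fun h => H1 5 1 (by decide) (by decide) (by decide) h5 h6 h
    have h11 : ¬ A 11 := fun h => H1 1 2 (by decide) (by decide) (by decide) h1 h3 h
    have h67 : A 67 := by_contra fun h => H0 9 2 (by decide) (by decide) (by decide) h9 h11 h
    have h139 : ¬ A 139 := fun h => H1 1 66 (by decide) (by decide) (by decide) h1 h67 h
    exact H0 13 24 (by decide) (by decide) (by decide) h13 h37 h139
  · have h40 : A 40 := by_contra fun h => H0 2 13 (by decide) (by decide) (by decide) h2 h15 h
    have h85 : ¬ A 85 := fun h => H1 1 39 (by decide) (by decide) (by decide) h1 h40 h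
    have h11 : A 11 := by_contra fun h => H0 11 4 (by decide) (by decide) (by decide) h h15 h85
    have h3 : ¬ A 3 := fun h => H1 1 2 (by decide) (by decide) (by decide) h1 h h11
    have h27 : ¬ A 27 := fun h => H1 1 10 (by decide) (by decide) (by decide) h1 h11 h
    have h6 : A 6 := by_contra fun h => H0 3 3 (by decide) (by decide) (by decide) h3 h h27
    have h17 : ¬ A 17 := fun h => H1 1 5 (by decide) (by decide) (by decide) h1 h6 h
    have h45 : A 45 := by_contra fun h => H0 3 12 (by decide) (by decide) (by decide) h3 h15 h
    have h20 : ¬ A 20 := fun h => H1 1 19 (by decide) (by decide) (by decide) h1 h h45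
    have h35 : A 35 := by_contra fun h => H0 3 32 (by decide) (by decide) (by decide) h3 h h85
    have h125 : ¬ A 125 := fun h => H1 11 24 (by decide) (by decide) (by decide) h11 h35 h
    exact H0 17 3 (by decide) (by decide) (by decide) h17 h20 h125

set_option synthInstance.maxHeartbeats 400000 in
set_option synthInstance.maxSize 2000 in
theorem stmt_13 :
    (∀ χ : ℕ → Fin 2, ∃ x d : ℕ, 0 < x ∧ 0 < d ∧ 7*x + 2*d ≤ 139 ∧ χ (x + d) = χ x ∧ χ (7*x + 2*d) = χ x) ∧
    (∃ χ : ℕ → Fin 2, ∀ x d : ℕ, 0 < x → 0 < d → 7*x + 2*d ≤ 138 → ¬(χ (x + d) = χ x ∧ χ (7*x + 2*d) = χ x)) := by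
  constructor
  · intro χ
    by_contra hc
    push Not at hc
    refine upper_aux_s13 (fun n => χ n = χ 1) rfl ?_ ?_
    · intro x d hx hd hn a b c
      exact hc x d hx hd hn (b.trans a.symm) (c.trans a.symm)
    · intro x d hx hd hn a b c
      have key : ∀ p q r s : Fin 2, p ≠ s → q ≠ s → r ≠ s → q = p ∧ r = p := by decide
      obtain ⟨e1, e2⟩ := key _ _ _ _ a b c
      exact hc x d hx hd hn e1 e2
  · refine ⟨fun n => if Nat.testBit 696898287454081663366417731982287668532734 n then 1 else 0, ?_⟩
    intro x d hx hd hn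
    have key : ∀ x < 20, ∀ d < 70, 0 < x → 0 < d → 7*x + 2*d ≤ 138 →
        ¬(Nat.testBit 696898287454081663366417731982287668532734 (x + d) = Nat.testBit 696898287454081663366417731982287668532734 x ∧
          Nat.testBit 696898287454081663366417731982287668532734 (7*x + 2*d) = Nat.testBit 696898287454081663366417731982287668532734 x) := by
      decide +kernel
    have inj : ∀ p q : Bool, (if p then (1 : Fin 2) else 0) = (if q then 1 else 0) → p = q := by decide
    rintro ⟨e1, e2⟩
    exact key x (by omega) d (by omega) hx hd hn ⟨inj _ _ e1, inj _ _ e2⟩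
end

section
/- T(2,6;2) = 114; that is, 114 is the least positive integer n such that every 2-coloring of {1,...,n} contains positive integers x, d with x, 2x + d, and 6x + 2d all the same color: every 2-coloring of {1,...,114} contains such a monochromatic triple, and some 2-coloring of {1,...,113} contains none. -/
/-- Excluding monochromatic triples `x, y, 2x+2y` with `2x < y` (that is, `y = 2x+d`)
leads to a contradiction by unit propagation and a small case tree. -/
theorem aux14 (b : ℕ → Bool) (H : ∀ x y z : ℕ, 0 < x ∧ 2*x < y ∧ z = 2*x+2*y ∧ z ≤ 114 → ¬(b y = b x ∧ b z = b x)) (f1 : b 1 = true) : False := by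
  rcases Bool.eq_false_or_eq_true (b 8) with f8 | f8
  · have f3 : b 3 = false := by simpa [f1, f8] using H 1 3 8 (by decide)
    have f18 : b 18 = false := by simpa [f1, f8] using H 1 8 18 (by decide)
    have f42 : b 42 = true := by simpa [f3, f18] using H 3 18 42 (by decide)
    have f20 : b 20 = false := by simpa [f1, f42] using H 1 20 42 (by decide)
    have f86 : b 86 = false := by simpa [f1, f42] using H 1 42 86 (by decide)
    have f100 : b 100 = false := by simpa [f8, f42] using H 8 42 100 (by decide)
    have f7 : b 7 = true := by simpa [f3, f20] using H 3 7 20 (by decide)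
    have f46 : b 46 = true := by simpa [f3, f20] using H 3 20 46 (by decide)
    have f40 : b 40 = true := by simpa [f3, f86] using H 3 40 86 (by decide)
    have f47 : b 47 = true := by simpa [f3, f100] using H 3 47 100 (by decide)
    have f16 : b 16 = false := by simpa [f1, f7] using H 1 7 16 (by decide)
    have f94 : b 94 = false := by simpa [f7, f40] using H 7 40 94 (by decide)
    have f106 : b 106 = false := by simpa [f7, f46] using H 7 46 106 (by decide)
    have f110 : b 110 = false := by simpa [f8, f47] using H 8 47 110 (by decide)
    have f38 : b 38 = true := by simpa [f3, f16] using H 3 16 38 (by decide)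
    have f34 : b 34 = true := by simpa [f16, f100] using H 16 34 100 (by decide)
    have f44 : b 44 = true := by simpa [f3, f94] using H 3 44 94 (by decide)
    have f50 : b 50 = true := by simpa [f3, f106] using H 3 50 106 (by decide)
    have f52 : b 52 = true := by simpa [f3, f110] using H 3 52 110 (by decide)
    have f92 : b 92 = false := by simpa [f8, f38] using H 8 38 92 (by decide)
    have f70 : b 70 = false := by simpa [f1, f34] using H 1 34 70 (by decide)
    have f15 : b 15 = false := by simpa [f7, f44] using H 7 15 44 (by decide)
    have f24 : b 24 = false := by simpa [f1, f50] using H 1 24 50 (by decide)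
    have f25 : b 25 = false := by simpa [f1, f52] using H 1 25 52 (by decide)
    have f31 : b 31 = true := by simpa [f15, f92] using H 15 31 92 (by decide)
    have f32 : b 32 = true := by simpa [f3, f70] using H 3 32 70 (by decide)
    have f11 : b 11 = true := by simpa [f24, f70] using H 11 24 70 (by decide)
    have f56 : b 56 = true := by simpa [f3, f25] using H 3 25 56 (by decide)
    have f64 : b 64 = false := by simpa [f1, f31] using H 1 31 64 (by decide)
    have f5 : b 5 = false := by simpa [f11, f32] using H 5 11 32 (by decide)
    have f27 : b 27 = false := by simpa [f1, f56] using H 1 27 56 (by decide)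
    simpa [f5, f27, f64] using H 5 27 64 (by decide)
  · rcases Bool.eq_false_or_eq_true (b 24) with f24 | f24
    · have f11 : b 11 = false := by simpa [f1, f24] using H 1 11 24 (by decide)
      have f50 : b 50 = false := by simpa [f1, f24] using H 1 24 50 (by decide)
      have f17 : b 17 = true := by simpa [f8, f50] using H 8 17 50 (by decide)
      have f36 : b 36 = false := by simpa [f1, f17] using H 1 17 36 (by decide)
      have f88 : b 88 = true := by simpa [f8, f36] using H 8 36 88 (by decide)
      have f94 : b 94 = true := by simpa [f11, f36] using H 11 36 94 (by decide)
      have f43 : b 43 = false := by simpa [f1, f88] using H 1 43 88 (by decide)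
      have f46 : b 46 = false := by simpa [f1, f94] using H 1 46 94 (by decide)
      have f108 : b 108 = true := by simpa [f11, f43] using H 11 43 108 (by decide)
      have f114 : b 114 = true := by simpa [f11, f46] using H 11 46 114 (by decide)
      have f37 : b 37 = false := by simpa [f17, f108] using H 17 37 108 (by decide)
      have f56 : b 56 = false := by simpa [f1, f114] using H 1 56 114 (by decide)
      have f40 : b 40 = false := by simpa [f17, f114] using H 17 40 114 (by decide)
      have f90 : b 90 = true := by simpa [f8, f37] using H 8 37 90 (by decide)
      have f20 : b 20 = true := by simpa [f8, f56] using H 8 20 56 (by decide)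
      have f44 : b 44 = false := by simpa [f1, f90] using H 1 44 90 (by decide)
      have f9 : b 9 = false := by simpa [f1, f20] using H 1 9 20 (by decide)
      have f106 : b 106 = true := by simpa [f9, f44] using H 9 44 106 (by decide)
      have f98 : b 98 = true := by simpa [f9, f40] using H 9 40 98 (by decide)
      have f52 : b 52 = false := by simpa [f1, f106] using H 1 52 106 (by decide)
      have f18 : b 18 = true := by simpa [f8, f52] using H 8 18 52 (by decide)
      rcases Bool.eq_false_or_eq_true (b 2) with f2 | f2
      · have f7 : b 7 = false := by simpa [f2, f18] using H 2 7 18 (by decide)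
        have f15 : b 15 = true := by simpa [f7, f44] using H 7 15 44 (by decide)
        have f16 : b 16 = true := by simpa [f7, f46] using H 7 16 46 (by decide)
        have f32 : b 32 = false := by simpa [f1, f15] using H 1 15 32 (by decide)
        have f6 : b 6 = false := by simpa [f2, f16] using H 2 6 16 (by decide)
        have f5 : b 5 = true := by simpa [f11, f32] using H 5 11 32 (by decide)
        have f14 : b 14 = true := by simpa [f6, f40] using H 6 14 40 (by decide)
        simpa [f2, f5, f14] using H 2 5 14 (by decide)
      · have f26 : b 26 = true := by simpa [f2, f11] using H 2 11 26 (by decide)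
        have f16 : b 16 = true := by simpa [f2, f36] using H 2 16 36 (by decide)
        have f12 : b 12 = false := by simpa [f1, f26] using H 1 12 26 (by decide)
        have f34 : b 34 = false := by simpa [f1, f16] using H 1 16 34 (by decide)
        have f33 : b 33 = false := by simpa [f16, f98] using H 16 33 98 (by decide)
        have f28 : b 28 = true := by simpa [f2, f12] using H 2 12 28 (by decide)
        have f5 : b 5 = true := by simpa [f12, f34] using H 5 12 34 (by decide)
        have f70 : b 70 = true := by simpa [f2, f33] using H 2 33 70 (by decide)
        have f13 : b 13 = false := by simpa [f1, f28] using H 1 13 28 (by decide)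
        have f30 : b 30 = false := by simpa [f5, f70] using H 5 30 70 (by decide)
        simpa [f2, f13, f30] using H 2 13 30 (by decide)
    · have f64 : b 64 = true := by simpa [f8, f24] using H 8 24 64 (by decide)
      have f31 : b 31 = false := by simpa [f1, f64] using H 1 31 64 (by decide)
      have f78 : b 78 = true := by simpa [f8, f31] using H 8 31 78 (by decide)
      have f38 : b 38 = false := by simpa [f1, f78] using H 1 38 78 (by decide)
      have f92 : b 92 = true := by simpa [f8, f38] using H 8 38 92 (by decide)
      have f45 : b 45 = false := by simpa [f1, f92] using H 1 45 92 (by decide)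
      have f106 : b 106 = true := by simpa [f8, f45] using H 8 45 106 (by decide)
      have f52 : b 52 = false := by simpa [f1, f106] using H 1 52 106 (by decide)
      have f2 : b 2 = true := by simpa [f24, f52] using H 2 24 52 (by decide)
      have f18 : b 18 = true := by simpa [f8, f52] using H 8 18 52 (by decide)
      have f7 : b 7 = false := by simpa [f2, f18] using H 2 7 18 (by decide)
      have f40 : b 40 = false := by simpa [f2, f18] using H 2 18 40 (by decide)
      have f44 : b 44 = false := by simpa [f2, f92] using H 2 44 92 (by decide)
      have f15 : b 15 = true := by simpa [f7, f44] using H 7 15 44 (by decide)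
      have f94 : b 94 = true := by simpa [f7, f40] using H 7 40 94 (by decide)
      have f102 : b 102 = true := by simpa [f7, f44] using H 7 44 102 (by decide)
      have f32 : b 32 = false := by simpa [f1, f15] using H 1 15 32 (by decide)
      have f46 : b 46 = false := by simpa [f1, f94] using H 1 46 94 (by decide)
      have f50 : b 50 = false := by simpa [f1, f102] using H 1 50 102 (by decide)
      have f16 : b 16 = true := by simpa [f7, f46] using H 7 16 46 (by decide)
      have f114 : b 114 = true := by simpa [f7, f50] using H 7 50 114 (by decide)
      have f6 : b 6 = false := by simpa [f2, f16] using H 2 6 16 (by decide)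
      have f56 : b 56 = false := by simpa [f1, f114] using H 1 56 114 (by decide)
      have f13 : b 13 = true := by simpa [f6, f38] using H 6 13 38 (by decide)
      have f14 : b 14 = true := by simpa [f6, f40] using H 6 14 40 (by decide)
      have f28 : b 28 = false := by simpa [f1, f13] using H 1 13 28 (by decide)
      have f5 : b 5 = false := by simpa [f2, f14] using H 2 5 14 (by decide)
      have f68 : b 68 = true := by simpa [f6, f28] using H 6 28 68 (by decide)
      have f11 : b 11 = true := by simpa [f5, f32] using H 5 11 32 (by decide)
      have f23 : b 23 = true := by simpa [f5, f56] using H 5 23 56 (by decide)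
      simpa [f11, f23, f68] using H 11 23 68 (by decide)

/-- The upper bound is `aux14`, applied to the coloring relative to one fixed colour class;
the lower bound is an explicit union of intervals, checked by linear arithmetic. -/
theorem stmt_14 :
    (∀ χ : ℕ → Fin 2, ∃ x d : ℕ, 0 < x ∧ 0 < d ∧ 6*x + 2*d ≤ 114 ∧ χ (2*x + d) = χ x ∧ χ (6*x + 2*d) = χ x) ∧
    (∃ χ : ℕ → Fin 2, ∀ x d : ℕ, 0 < x → 0 < d → 6*x + 2*d ≤ 113 → ¬(χ (2*x + d) = χ x ∧ χ (6*x + 2*d) = χ x)) := by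
  constructor
  · intro χ
    by_contra hn
    refine aux14 (fun n => decide (χ n = χ 1)) ?_ (by simp)
    rintro x y z ⟨hx, hy, hz, hle⟩ hb
    apply hn
    refine ⟨x, y - 2*x, hx, by omega, by omega, ?_⟩
    have e1 : 2*x + (y - 2*x) = y := by omega
    have e2 : 6*x + 2*(y - 2*x) = z := by omega
    rw [e1, e2]
    generalize χ x = p at *
    generalize χ y = q at *
    generalize χ z = r at *
    generalize χ 1 = s at *
    revert p q r s
    decide
  · refine ⟨fun n => if n ≤ 4 ∨ (11 ≤ n ∧ n ≤ 22) ∨ 56 ≤ n then 0 else 1, ?_⟩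
    rintro x d hx hd hle ⟨h1, h2⟩
    simp only at h1 h2
    split_ifs at h1 h2 <;> omega
end

section
/- T(2,7;2) = 159; that is, 159 is the least positive integer n such that every 2-coloring of {1,...,n} contains positive integers x, d with x, 2x + d, and 7x + 2d all the same color: every 2-coloring of {1,...,159} contains such a monochromatic triple, and some 2-coloring of {1,...,158} contains none. -/
/-- Refutation trees: `node v l r` splits on the color of `v`; `leaf x d` names a violated triple. -/
inductive RTree where
  | leaf (x d : ℕ) : RTree
  | node (v : ℕ) (l r : RTree) : RTree

/-- `p`, `q` are bit masks of the numbers currently known to have color `true` / `false`. -/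
def RTree.check : RTree → ℕ → ℕ → Bool
  | .leaf x d, p, q =>
    (Nat.ble 1 x && Nat.ble 1 d && Nat.ble (7*x + 2*d) 159) &&
      ((p.testBit x && p.testBit (2*x + d) && p.testBit (7*x + 2*d)) ||
       (q.testBit x && q.testBit (2*x + d) && q.testBit (7*x + 2*d)))
  | .node v l r, p, q => l.check (p ||| 2^v) q && r.check p (q ||| 2^v)

theorem RTree.sound (c : ℕ → Bool) (t : RTree) : ∀ p q : ℕ,
    (∀ v, p.testBit v = true → c v = true) → (∀ v, q.testBit v = true → c v = false) →
    t.check p q = true →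
    ∃ x d : ℕ, 0 < x ∧ 0 < d ∧ 7*x + 2*d ≤ 159 ∧ c (2*x + d) = c x ∧ c (7*x + 2*d) = c x := by
  induction t with
  | leaf x d =>
    intro p q hp hq h
    simp only [RTree.check, Bool.and_eq_true, Bool.or_eq_true, Nat.ble_eq] at h
    obtain ⟨⟨⟨hx, hd⟩, hn⟩, h⟩ := h
    refine ⟨x, d, hx, hd, hn, ?_⟩
    rcases h with ⟨⟨h1, h2⟩, h3⟩ | ⟨⟨h1, h2⟩, h3⟩
    · rw [hp _ h1, hp _ h2, hp _ h3]; exact ⟨rfl, rfl⟩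
    · rw [hq _ h1, hq _ h2, hq _ h3]; exact ⟨rfl, rfl⟩
  | node v l r ihl ihr =>
    intro p q hp hq h
    simp only [RTree.check, Bool.and_eq_true] at h
    cases hv : c v with
    | true =>
      refine ihl _ q (fun w hw => ?_) hq h.1
      rw [Nat.testBit_or, Bool.or_eq_true, Nat.testBit_two_pow] at hw
      rcases hw with hw | hw
      · exact hp w hw
      · rw [← of_decide_eq_true hw]; exact hv
    | false =>
      refine ihr p _ hp (fun w hw => ?_) h.2
      rw [Nat.testBit_or, Bool.or_eq_true, Nat.testBit_two_pow] at hw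
      rcases hw with hw | hw
      · exact hq w hw
      · rw [← of_decide_eq_true hw]; exact hv

set_option maxRecDepth 100000 in
/-- The refutation for `n = 159`. -/
def refutation : RTree :=
  .node 1 (.node 9 (.node 3 (.leaf 1 1) (.node 21 (.leaf 1 7) (.node 51 (.node 24 (.leaf 1 22)
  (.node 105 (.leaf 1 49) (.node 57 (.node 48 (.node 27 (.leaf 1 25) (.node 141 (.leaf 9 39)
  (.node 99 (.leaf 1 46) (.node 63 (.node 66 (.node 45 (.node 30 (.leaf 1 28) (.node 159 (.leaf 9
  48) (.node 93 (.leaf 1 43) (.node 13 (.node 75 (.node 42 (.node 5 (.leaf 1 3) (.node 36 (.leaf 1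
  34) (.node 87 (.leaf 1 40) (.leaf 5 26)))) (.leaf 3 36)) (.leaf 3 69)) (.leaf 13 4))))) (.leaf 3
  39)) (.leaf 3 60)) (.leaf 3 21))))) (.leaf 3 42)) (.leaf 3 18)))) (.leaf 3 15)))) (.node 27
  (.node 12 (.leaf 1 10) (.node 57 (.leaf 1 25) (.node 141 (.node 69 (.leaf 1 67) (.node 21 (.node
  45 (.leaf 1 19) (.node 19 (.node 8 (.leaf 1 6) (.node 41 (.leaf 1 17) (.node 42 (.leaf 19 4)
  (.node 109 (.node 111 (.node 53 (.leaf 1 51) (.node 54 (.leaf 1 52) (.node 130 (.node 135 (.node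
  39 (.leaf 19 1) (.node 5 (.node 13 (.leaf 1 3) (.node 60 (.leaf 5 50) (.node 145 (.node 18
  (.node 44 (.leaf 19 6) (.node 38 (.leaf 18 2) (.node 6 (.node 4 (.node 15 (.leaf 1 4) (.node 2
  (.leaf 2 2) (.node 36 (.node 84 (.leaf 4 28) (.leaf 2 35)) (.leaf 2 11)))) (.leaf 4 5)) (.leaf 6
  1)))) (.leaf 8 2)) (.leaf 13 27)))) (.leaf 5 2))) (.leaf 9 36)) (.leaf 8 37)))) (.leaf 9 24))
  (.leaf 9 23))))) (.node 65 (.node 147 (.node 31 (.leaf 1 29) (.node 133 (.leaf 1 63) (.node 72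
  (.leaf 1 70) (.node 89 (.node 53 (.node 43 (.leaf 1 41) (.node 25 (.leaf 1 23) (.node 109 (.leaf
  1 51) (.node 113 (.node 77 (.node 41 (.node 55 (.leaf 1 53) (.node 37 (.leaf 1 35) (.node 85
  (.leaf 1 39) (.node 137 (.node 101 (.node 29 (.node 67 (.leaf 1 65) (.node 49 (.leaf 1 47)
  (.node 13 (.leaf 1 11) (.node 20 (.node 155 (.node 35 (.node 47 (.node 153 (.node 46 (.leaf 21
  4) (.node 73 (.leaf 1 33) (.node 22 (.leaf 1 20) (.node 75 (.leaf 1 73) (.node 23 (.node 24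
  (.node 10 (.leaf 1 8) (.node 51 (.leaf 1 22) (.node 144 (.node 159 (.node 42 (.leaf 20 2) (.node
  78 (.leaf 1 76) (.node 2 (.node 7 (.leaf 2 3) (.node 15 (.node 6 (.leaf 1 4) (.node 14 (.node 30
  (.node 102 (.leaf 14 2) (.leaf 6 30)) (.leaf 6 18)) (.leaf 6 2))) (.leaf 7 1))) (.node 8 (.node
  33 (.node 90 (.leaf 8 17) (.leaf 2 38)) (.leaf 2 29)) (.leaf 2 4))))) (.leaf 19 13)) (.leaf 10
  37)))) (.leaf 9 6)) (.leaf 9 5)))))) (.leaf 13 31)) (.leaf 13 21)) (.leaf 13 9)) (.leaf 19 11))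
  (.leaf 9 2))))) (.leaf 9 11)) (.leaf 9 19)) (.leaf 9 37))))) (.leaf 9 23)) (.leaf 9 7)) (.leaf 9
  25))))) (.leaf 9 35)) (.leaf 9 13))))) (.leaf 19 7)) (.leaf 9 1)))) (.leaf 9 3))) (.leaf 9
  39)))) (.node 3 (.node 81 (.node 36 (.leaf 3 30) (.node 39 (.leaf 1 37) (.node 99 (.node 105
  (.node 48 (.leaf 1 46) (.node 51 (.leaf 1 49) (.node 123 (.node 129 (.node 60 (.leaf 1 58)
  (.node 57 (.leaf 3 51) (.node 63 (.leaf 1 61) (.node 2 (.node 147 (.node 141 (.node 153 (.node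
  72 (.leaf 1 70) (.node 66 (.leaf 3 60) (.node 75 (.leaf 1 73) (.node 6 (.node 4 (.node 7 (.node
  18 (.leaf 2 2) (.node 11 (.leaf 1 2) (.node 20 (.leaf 2 3) (.node 8 (.node 67 (.node 19 (.leaf 1
  6) (.node 25 (.leaf 3 2) (.node 137 (.leaf 1 65) (.node 40 (.node 83 (.leaf 1 38) (.leaf 11 3))
  (.leaf 19 2))))) (.leaf 9 2)) (.leaf 8 2))))) (.leaf 7 13)) (.leaf 4 19)) (.leaf 6 15)))))
  (.leaf 9 45)) (.leaf 9 39)) (.leaf 9 42)) (.leaf 2 23))))) (.leaf 9 33)) (.leaf 9 30)))) (.leaf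
  9 21)) (.leaf 9 18)))) (.leaf 9 9)) (.leaf 3 3)))) (.node 9 (.node 27 (.node 3 (.leaf 3 3)
  (.node 81 (.leaf 9 9) (.node 36 (.node 39 (.node 99 (.leaf 9 18) (.node 105 (.leaf 9 21) (.node
  48 (.node 51 (.node 123 (.leaf 9 30) (.node 129 (.leaf 9 33) (.node 60 (.node 57 (.node 63
  (.node 2 (.leaf 2 23) (.node 147 (.leaf 9 42) (.node 141 (.leaf 9 39) (.node 153 (.leaf 9 45)
  (.node 72 (.node 66 (.node 75 (.node 6 (.leaf 6 15) (.node 4 (.leaf 4 19) (.node 7 (.leaf 7 13)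
  (.node 18 (.node 11 (.node 20 (.node 8 (.leaf 8 2) (.node 67 (.leaf 9 2) (.node 19 (.node 25
  (.node 137 (.node 40 (.leaf 19 2) (.node 83 (.leaf 11 3) (.leaf 1 38))) (.leaf 1 65)) (.leaf 3
  2)) (.leaf 1 6)))) (.leaf 2 3)) (.leaf 1 2)) (.leaf 2 2))))) (.leaf 1 73)) (.leaf 3 60)) (.leaf
  1 70)))))) (.leaf 1 61)) (.leaf 3 51)) (.leaf 1 58)))) (.leaf 1 49)) (.leaf 1 46)))) (.leaf 1
  37)) (.leaf 3 30)))) (.node 12 (.node 57 (.node 141 (.leaf 9 39) (.node 69 (.node 21 (.leaf 9 3)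
  (.node 45 (.node 19 (.node 65 (.leaf 9 1) (.node 147 (.leaf 19 7) (.node 31 (.node 133 (.node 72
  (.node 89 (.leaf 9 13) (.node 53 (.leaf 9 35) (.node 43 (.node 25 (.node 109 (.node 113 (.leaf 9
  25) (.node 77 (.leaf 9 7) (.node 41 (.leaf 9 23) (.node 55 (.node 37 (.node 85 (.node 137 (.leaf
  9 37) (.node 101 (.leaf 9 19) (.node 29 (.leaf 9 11) (.node 67 (.node 49 (.node 13 (.node 20
  (.leaf 9 2) (.node 155 (.leaf 19 11) (.node 35 (.leaf 13 9) (.node 47 (.leaf 13 21) (.node 153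
  (.leaf 13 31) (.node 46 (.node 73 (.node 22 (.node 75 (.node 23 (.leaf 9 5) (.node 24 (.leaf 9
  6) (.node 10 (.node 51 (.node 144 (.leaf 10 37) (.node 159 (.leaf 19 13) (.node 42 (.node 78
  (.node 2 (.node 8 (.leaf 2 4) (.node 33 (.leaf 2 29) (.node 90 (.leaf 2 38) (.leaf 8 17))))
  (.node 7 (.node 15 (.leaf 7 1) (.node 6 (.node 14 (.leaf 6 2) (.node 30 (.leaf 6 18) (.node 102
  (.leaf 6 30) (.leaf 14 2)))) (.leaf 1 4))) (.leaf 2 3))) (.leaf 1 76)) (.leaf 20 2)))) (.leaf 1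
  22)) (.leaf 1 8)))) (.leaf 1 73)) (.leaf 1 20)) (.leaf 1 33)) (.leaf 21 4))))))) (.leaf 1 11))
  (.leaf 1 47)) (.leaf 1 65))))) (.leaf 1 39)) (.leaf 1 35)) (.leaf 1 53))))) (.leaf 1 51)) (.leaf
  1 23)) (.leaf 1 41)))) (.leaf 1 70)) (.leaf 1 63)) (.leaf 1 29)))) (.node 8 (.node 41 (.node 42
  (.node 109 (.leaf 9 23) (.node 111 (.leaf 9 24) (.node 53 (.node 54 (.node 130 (.leaf 8 37)
  (.node 135 (.leaf 9 36) (.node 39 (.node 5 (.leaf 5 2) (.node 13 (.node 60 (.node 145 (.leaf 13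
  27) (.node 18 (.leaf 8 2) (.node 44 (.node 38 (.node 6 (.leaf 6 1) (.node 4 (.leaf 4 5) (.node
  15 (.node 2 (.node 36 (.leaf 2 11) (.node 84 (.leaf 2 35) (.leaf 4 28))) (.leaf 2 2)) (.leaf 1
  4)))) (.leaf 18 2)) (.leaf 19 6)))) (.leaf 5 50)) (.leaf 1 3))) (.leaf 19 1)))) (.leaf 1 52))
  (.leaf 1 51)))) (.leaf 19 4)) (.leaf 1 17)) (.leaf 1 6))) (.leaf 1 19))) (.leaf 1 67))) (.leaf 1
  25)) (.leaf 1 10))) (.node 3 (.node 21 (.node 51 (.leaf 3 15) (.node 24 (.node 105 (.node 57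
  (.leaf 3 18) (.node 48 (.leaf 3 42) (.node 27 (.node 141 (.node 99 (.node 63 (.leaf 3 21) (.node
  66 (.leaf 3 60) (.node 45 (.leaf 3 39) (.node 30 (.node 159 (.node 93 (.node 13 (.leaf 13 4)
  (.node 75 (.leaf 3 69) (.node 42 (.leaf 3 36) (.node 5 (.node 36 (.node 87 (.leaf 5 26) (.leaf 1
  40)) (.leaf 1 34)) (.leaf 1 3))))) (.leaf 1 43)) (.leaf 9 48)) (.leaf 1 28))))) (.leaf 1 46))
  (.leaf 9 39)) (.leaf 1 25)))) (.leaf 1 49)) (.leaf 1 22))) (.leaf 1 7)) (.leaf 1 1)))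

set_option maxRecDepth 100000 in
theorem refutation_check : refutation.check 0 0 = true := by decide +kernel

/-- The set of numbers of color `1` in a good coloring of `1..158`. -/
def goodMask : ℕ := 208785948190128988314812162135391131901736075200

set_option maxRecDepth 100000 in
theorem goodMask_check : ∀ x : Fin 23, ∀ d : Fin 80, (0 < x.val ∧ 0 < d.val ∧ 7*x.val + 2*d.val ≤ 158) →
    ¬(goodMask.testBit (2*x.val + d.val) = goodMask.testBit x.val ∧
      goodMask.testBit (7*x.val + 2*d.val) = goodMask.testBit x.val) := by
  decide +kernel

theorem stmt_15 :
    (∀ χ : ℕ → Fin 2, ∃ x d : ℕ, 0 < x ∧ 0 < d ∧ 7*x + 2*d ≤ 159 ∧ χ (2*x + d) = χ x ∧ χ (7*x + 2*d) = χ x) ∧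
    (∃ χ : ℕ → Fin 2, ∀ x d : ℕ, 0 < x → 0 < d → 7*x + 2*d ≤ 158 → ¬(χ (2*x + d) = χ x ∧ χ (7*x + 2*d) = χ x)) := by
  constructor
  · intro χ
    have key : ∀ a b : Fin 2, decide (a = 1) = decide (b = 1) → a = b := by decide
    obtain ⟨x, d, hx, hd, hn, h1, h2⟩ := RTree.sound (fun n => decide (χ n = 1)) refutation 0 0
      (by simp) (by simp) refutation_check
    exact ⟨x, d, hx, hd, hn, key _ _ h1, key _ _ h2⟩
  · have key : ∀ a b : Bool, (if a = true then (1 : Fin 2) else 0) = (if b = true then 1 else 0) →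
        a = b := by decide
    refine ⟨fun n => if goodMask.testBit n = true then 1 else 0, fun x d hx hd hn h => ?_⟩
    exact goodMask_check ⟨x, by omega⟩ ⟨d, by omega⟩ ⟨hx, hd, hn⟩ ⟨key _ _ h.1, key _ _ h.2⟩
end

section
/- T(3,7;2) = 247; that is, 247 is the least positive integer n such that every 2-coloring of {1,...,n} contains positive integers x, d with x, 3x + d, and 7x + 2d all the same color: every 2-coloring of {1,...,247} contains such a monochromatic triple, and some 2-coloring of {1,...,246} contains none. -/
/-- `Good c`: the coloring `c` has no monochromatic triple `(x, y, x + 2 y)`, `y > 3 x`, in `[1, 247]`. -/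
def Good (c : ℕ → Bool) : Prop :=
  ∀ x y z : ℕ, (0 < x ∧ 3 * x < y ∧ z = x + 2 * y ∧ z ≤ 247) →
    ∀ b, c x = b → c y = b → c z = b → False

theorem ff {c : ℕ → Bool} (h : Good c) (x y z : ℕ)
    (hh : 0 < x ∧ 3 * x < y ∧ z = x + 2 * y ∧ z ≤ 247) {b : Bool}
    (h1 : c x = b) (h2 : c y = b) (h3 : c z = b) : False := h x y z hh b h1 h2 h3

theorem fx {c : ℕ → Bool} (h : Good c) (x y z : ℕ)
    (hh : 0 < x ∧ 3 * x < y ∧ z = x + 2 * y ∧ z ≤ 247) {b : Bool}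
    (h2 : c y = b) (h3 : c z = b) : c x = !b := by
  have := h x y z hh b
  cases b <;> cases hx : c x <;> simp_all

theorem fy {c : ℕ → Bool} (h : Good c) (x y z : ℕ)
    (hh : 0 < x ∧ 3 * x < y ∧ z = x + 2 * y ∧ z ≤ 247) {b : Bool}
    (h1 : c x = b) (h3 : c z = b) : c y = !b := by
  have := h x y z hh b
  cases b <;> cases hx : c y <;> simp_all

theorem fz {c : ℕ → Bool} (h : Good c) (x y z : ℕ)
    (hh : 0 < x ∧ 3 * x < y ∧ z = x + 2 * y ∧ z ≤ 247) {b : Bool}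
    (h1 : c x = b) (h2 : c y = b) : c z = !b := by
  have := h x y z hh b
  cases b <;> cases hx : c z <;> simp_all

theorem bc (c : ℕ → Bool) (n : ℕ) : c n = true ∨ c n = false := by
  cases c n <;> simp

theorem core_s16 (c : ℕ → Bool) (h : Good c) (e5 : c 5 = true) : False := by
  rcases bc c 39 with e39 | e39
  · have e17 := fy h 5 17 39 (by decide) e5 e39
    have e83 := fz h 5 39 83 (by decide) e5 e39
    have e183 := fz h 17 83 183 (by decide) e17 e83
    have e89 := fy h 5 89 183 (by decide) e5 e183
    have e195 := fz h 17 89 195 (by decide) e17 e89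
    have e95 := fy h 5 95 195 (by decide) e5 e195
    have e207 := fz h 17 95 207 (by decide) e17 e95
    have e101 := fy h 5 101 207 (by decide) e5 e207
    have e219 := fz h 17 101 219 (by decide) e17 e101
    have e107 := fy h 5 107 219 (by decide) e5 e219
    have e231 := fz h 17 107 231 (by decide) e17 e107
    have e113 := fy h 5 113 231 (by decide) e5 e231
    have e243 := fz h 17 113 243 (by decide) e17 e113
    have e119 := fy h 5 119 243 (by decide) e5 e243
    rcases bc c 1 with e1 | e1
    · have e11 := fz h 1 5 11 (by decide) e1 e5
      have e19 := fy h 1 19 39 (by decide) e1 e39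
      have e79 := fz h 1 39 79 (by decide) e1 e39
      have e109 := fy h 1 109 219 (by decide) e1 e219
      have e115 := fy h 1 115 231 (by decide) e1 e231
      have e34 := fy h 11 34 79 (by decide) e11 e79
      have e49 := fy h 11 49 109 (by decide) e11 e109
      have e245 := fz h 19 113 245 (by decide) e19 e113
      have e247 := fz h 17 115 247 (by decide) e17 e115
      have e69 := fz h 1 34 69 (by decide) e1 e34
      have e24 := fy h 1 24 49 (by decide) e1 e49
      have e122 := fy h 1 122 245 (by decide) e1 e245
      have e123 := fy h 1 123 247 (by decide) e1 e247
      have e2 := fx h 2 11 24 (by decide) e11 e24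
      have e70 := fz h 2 34 70 (by decide) e2 e34
      rcases bc c 4 with e4 | e4
      · have e9 := fz h 1 4 9 (by decide) e1 e4
        have e30 := fy h 9 30 69 (by decide) e9 e69
        have e57 := fy h 9 57 123 (by decide) e9 e123
        have e65 := fz h 5 30 65 (by decide) e5 e30
        have e28 := fy h 1 28 57 (by decide) e1 e57
        exact ff h 9 28 65 (by decide) e9 e28 e65
      · have e33 := fy h 4 33 70 (by decide) e4 e70
        have e59 := fy h 4 59 122 (by decide) e4 e122
        have e68 := fz h 2 33 68 (by decide) e2 e33
        have e29 := fy h 1 29 59 (by decide) e1 e59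
        have e32 := fy h 4 32 68 (by decide) e4 e68
        have e62 := fz h 4 29 62 (by decide) e4 e29
        have e65 := fz h 1 32 65 (by decide) e1 e32
        have e66 := fz h 2 32 66 (by decide) e2 e32
        have e30 := fy h 2 30 62 (by decide) e2 e62
        have e134 := fz h 4 65 134 (by decide) e4 e65
        have e6 := fx h 6 30 66 (by decide) e30 e66
        have e64 := fz h 4 30 64 (by decide) e4 e30
        exact ff h 6 64 134 (by decide) e6 e64 e134
    · have e35 := fz h 1 17 35 (by decide) e1 e17
      have e59 := fy h 1 59 119 (by decide) e1 e119
      have e75 := fz h 5 35 75 (by decide) e5 e35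
      have e27 := fy h 5 27 59 (by decide) e5 e59
      have e123 := fz h 5 59 123 (by decide) e5 e59
      have e151 := fz h 1 75 151 (by decide) e1 e75
      have e13 := fy h 1 13 27 (by decide) e1 e27
      have e61 := fy h 1 61 123 (by decide) e1 e123
      have e73 := fy h 5 73 151 (by decide) e5 e151
      have e135 := fz h 13 61 135 (by decide) e13 e61
      have e147 := fz h 1 73 147 (by decide) e1 e73
      have e67 := fy h 1 67 135 (by decide) e1 e135
      exact ff h 13 67 147 (by decide) e13 e67 e147
  · rcases bc c 1 with e1 | e1
    · have e11 := fz h 1 5 11 (by decide) e1 e5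
      have e89 := fz h 11 39 89 (by decide) e11 e39
      have e44 := fy h 1 44 89 (by decide) e1 e89
      have e179 := fz h 1 89 179 (by decide) e1 e89
      have e99 := fz h 11 44 99 (by decide) e11 e44
      have e84 := fy h 11 84 179 (by decide) e11 e179
      have e49 := fy h 1 49 99 (by decide) e1 e99
      have e169 := fz h 1 84 169 (by decide) e1 e84
      have e109 := fz h 11 49 109 (by decide) e11 e49
      have e79 := fy h 11 79 169 (by decide) e11 e169
      have e54 := fy h 1 54 109 (by decide) e1 e109
      have e159 := fz h 1 79 159 (by decide) e1 e79
      have e119 := fz h 11 54 119 (by decide) e11 e54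
      have e74 := fy h 11 74 159 (by decide) e11 e159
      have e59 := fy h 1 59 119 (by decide) e1 e119
      have e149 := fz h 1 74 149 (by decide) e1 e74
      have e129 := fz h 11 59 129 (by decide) e11 e59
      have e69 := fy h 11 69 149 (by decide) e11 e149
      have e64 := fy h 1 64 129 (by decide) e1 e129
      have e139 := fz h 1 69 139 (by decide) e1 e69
      exact ff h 11 64 139 (by decide) e11 e64 e139
    · have e19 := fy h 1 19 39 (by decide) e1 e39
      have e79 := fz h 1 39 79 (by decide) e1 e39
      have e43 := fz h 5 19 43 (by decide) e5 e19
      have e37 := fy h 5 37 79 (by decide) e5 e79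
      have e21 := fy h 1 21 43 (by decide) e1 e43
      have e75 := fz h 1 37 75 (by decide) e1 e37
      have e47 := fz h 5 21 47 (by decide) e5 e21
      have e35 := fy h 5 35 75 (by decide) e5 e75
      have e23 := fy h 1 23 47 (by decide) e1 e47
      have e71 := fz h 1 35 71 (by decide) e1 e35
      have e51 := fz h 5 23 51 (by decide) e5 e23
      have e33 := fy h 5 33 71 (by decide) e5 e71
      have e25 := fy h 1 25 51 (by decide) e1 e51
      have e67 := fz h 1 33 67 (by decide) e1 e33
      have e55 := fz h 5 25 55 (by decide) e5 e25
      have e31 := fy h 5 31 67 (by decide) e5 e67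
      have e27 := fy h 1 27 55 (by decide) e1 e55
      have e63 := fz h 1 31 63 (by decide) e1 e31
      have e59 := fz h 5 27 59 (by decide) e5 e27
      have e29 := fy h 5 29 63 (by decide) e5 e63
      exact ff h 1 29 59 (by decide) e1 e29 e59

theorem stmt_16 :
    (∀ χ : ℕ → Fin 2, ∃ x d : ℕ, 0 < x ∧ 0 < d ∧ 7*x + 2*d ≤ 247 ∧ χ (3*x + d) = χ x ∧ χ (7*x + 2*d) = χ x) ∧
    (∃ χ : ℕ → Fin 2, ∀ x d : ℕ, 0 < x → 0 < d → 7*x + 2*d ≤ 246 → ¬(χ (3*x + d) = χ x ∧ χ (7*x + 2*d) = χ x)) := by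
  constructor
  · intro χ
    by_contra hcon
    push Not at hcon
    refine core_s16 (fun n => decide (χ n = χ 5)) ?_ (by simp)
    rintro x y z ⟨h0, h1, rfl, h3⟩ b hx hy hz
    have key : ∀ m, decide (χ m = χ 5) = b → decide (χ x = χ 5) = b → χ m = χ x := by
      intro m hm hx
      cases b <;> simp only [decide_eq_true_eq, decide_eq_false_iff_not] at hm hx <;> omega
    have := hcon x (y - 3 * x) h0 (by omega) (by omega)
    rw [show 3 * x + (y - 3 * x) = y by omega,
      show 7 * x + 2 * (y - 3 * x) = x + 2 * y by omega] at this
    exact this (key y hy hx) (key _ hz hx)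
  · refine ⟨fun n => if (1 ≤ n ∧ n ≤ 8) ∨ n = 10 ∨ (28 ≤ n ∧ n ≤ 56) ∨ (123 ≤ n ∧ n ≤ 246) then 1 else 0, ?_⟩
    intro x d hx hd hle
    dsimp only
    split_ifs <;> simp <;> omega
end

section
/- T(4,6;2) = 144; that is, 144 is the least positive integer n such that every 2-coloring of {1,...,n} contains positive integers x, d with x, 4x + d, and 6x + 2d all the same color: every 2-coloring of {1,...,144} contains such a monochromatic triple, and some 2-coloring of {1,...,143} contains none. -/
theorem core_17 (p : ℕ → Prop) (t1 : p 1)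
    (hA : ∀ x d : ℕ, 0 < x → 0 < d → 6*x + 2*d ≤ 144 → p x → p (4*x + d) → p (6*x + 2*d) → False)
    (hB : ∀ x d : ℕ, 0 < x → 0 < d → 6*x + 2*d ≤ 144 → ¬ p x → ¬ p (4*x + d) → ¬ p (6*x + 2*d) → False) :
    False := by
  by_cases h8 : p 8
  · have t8 := h8
    have f5 : ¬ p 5 := fun h => hA 1 1 (by decide) (by decide) (by decide) t1 h t8
    have f14 : ¬ p 14 := fun h => hA 1 4 (by decide) (by decide) (by decide) t1 t8 h
    by_cases h21 : p 21
    · have t21 := h21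
      have f40 : ¬ p 40 := fun h => hA 1 17 (by decide) (by decide) (by decide) t1 t21 h
      have t25 : p 25 := by_contra fun h => hB 5 5 (by decide) (by decide) (by decide) f5 h f40
      have f48 : ¬ p 48 := fun h => hA 1 21 (by decide) (by decide) (by decide) t1 t25 h
      have t29 : p 29 := by_contra fun h => hB 5 9 (by decide) (by decide) (by decide) f5 h f48
      have f56 : ¬ p 56 := fun h => hA 1 25 (by decide) (by decide) (by decide) t1 t29 h
      have t70 : p 70 := by_contra fun h => hB 5 20 (by decide) (by decide) (by decide) f5 f40 h
      have f36 : ¬ p 36 := fun h => hA 1 32 (by decide) (by decide) (by decide) t1 h t70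
      have t62 : p 62 := by_contra fun h => hB 5 16 (by decide) (by decide) (by decide) f5 f36 h
      have f108 : ¬ p 108 := fun h => hA 8 30 (by decide) (by decide) (by decide) t8 t62 h
      have t2 : p 2 := by_contra fun h => hB 2 48 (by decide) (by decide) (by decide) h f56 f108
      have f32 : ¬ p 32 := fun h => hA 1 28 (by decide) (by decide) (by decide) t1 h t62
      have t54 : p 54 := by_contra fun h => hB 5 12 (by decide) (by decide) (by decide) f5 f32 h
      exact hA 2 21 (by decide) (by decide) (by decide) t2 t29 t54
    · have f21 := h21
      have t32 : p 32 := by_contra fun h => hB 5 1 (by decide) (by decide) (by decide) f5 f21 h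
      have f62 : ¬ p 62 := fun h => hA 1 28 (by decide) (by decide) (by decide) t1 t32 h
      have t36 : p 36 := by_contra fun h => hB 5 16 (by decide) (by decide) (by decide) f5 h f62
      have f70 : ¬ p 70 := fun h => hA 1 32 (by decide) (by decide) (by decide) t1 t36 h
      have t40 : p 40 := by_contra fun h => hB 5 20 (by decide) (by decide) (by decide) f5 h f70
      have f78 : ¬ p 78 := fun h => hA 1 36 (by decide) (by decide) (by decide) t1 t40 h
      have t44 : p 44 := by_contra fun h => hB 5 24 (by decide) (by decide) (by decide) f5 h f78
      have t112 : p 112 := by_contra fun h => hB 14 14 (by decide) (by decide) (by decide) f14 f70 h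
      have f57 : ¬ p 57 := fun h => hA 1 53 (by decide) (by decide) (by decide) t1 h t112
      have t86 : p 86 := by_contra fun h => hB 14 1 (by decide) (by decide) (by decide) f14 f57 h
      exact hA 1 40 (by decide) (by decide) (by decide) t1 t44 t86
  · have f8 := h8
    by_cases h33 : p 33
    · have t33 := h33
      have f64 : ¬ p 64 := fun h => hA 1 29 (by decide) (by decide) (by decide) t1 t33 h
      have t40 : p 40 := by_contra fun h => hB 8 8 (by decide) (by decide) (by decide) f8 h f64
      have f78 : ¬ p 78 := fun h => hA 1 36 (by decide) (by decide) (by decide) t1 t40 h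
      have t47 : p 47 := by_contra fun h => hB 8 15 (by decide) (by decide) (by decide) f8 h f78
      have f92 : ¬ p 92 := fun h => hA 1 43 (by decide) (by decide) (by decide) t1 t47 h
      have t54 : p 54 := by_contra fun h => hB 8 22 (by decide) (by decide) (by decide) f8 h f92
      have f6 : ¬ p 6 := fun h => hA 6 9 (by decide) (by decide) (by decide) h t33 t54
      have t112 : p 112 := by_contra fun h => hB 8 32 (by decide) (by decide) (by decide) f8 f64 h
      have f57 : ¬ p 57 := fun h => hA 1 53 (by decide) (by decide) (by decide) t1 h t112
      have t98 : p 98 := by_contra fun h => hB 8 25 (by decide) (by decide) (by decide) f8 f57 h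
      have f50 : ¬ p 50 := fun h => hA 1 46 (by decide) (by decide) (by decide) t1 h t98
      have t4 : p 4 := by_contra fun h => hB 4 34 (by decide) (by decide) (by decide) h f50 f92
      have f31 : ¬ p 31 := fun h => hA 4 15 (by decide) (by decide) (by decide) t4 h t54
      exact hB 6 7 (by decide) (by decide) (by decide) f6 f31 f50
    · have f33 := h33
      have t50 : p 50 := by_contra fun h => hB 8 1 (by decide) (by decide) (by decide) f8 f33 h
      have f26 : ¬ p 26 := fun h => hA 1 22 (by decide) (by decide) (by decide) t1 h t50
      have f98 : ¬ p 98 := fun h => hA 1 46 (by decide) (by decide) (by decide) t1 t50 h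
      have t57 : p 57 := by_contra fun h => hB 8 25 (by decide) (by decide) (by decide) f8 h f98
      have f112 : ¬ p 112 := fun h => hA 1 53 (by decide) (by decide) (by decide) t1 t57 h
      have t64 : p 64 := by_contra fun h => hB 8 32 (by decide) (by decide) (by decide) f8 h f112
      have f126 : ¬ p 126 := fun h => hA 1 60 (by decide) (by decide) (by decide) t1 t64 h
      have t71 : p 71 := by_contra fun h => hB 8 39 (by decide) (by decide) (by decide) f8 h f126
      have f140 : ¬ p 140 := fun h => hA 1 67 (by decide) (by decide) (by decide) t1 t71 h
      have t78 : p 78 := by_contra fun h => hB 8 46 (by decide) (by decide) (by decide) f8 h f140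
      have f40 : ¬ p 40 := fun h => hA 1 36 (by decide) (by decide) (by decide) t1 h t78
      have t6 : p 6 := by_contra fun h => hB 6 2 (by decide) (by decide) (by decide) h f26 f40
      have f10 : ¬ p 10 := fun h => hA 1 2 (by decide) (by decide) (by decide) t1 t6 h
      have t80 : p 80 := by_contra fun h => hB 10 40 (by decide) (by decide) (by decide) f10 h f140
      have f46 : ¬ p 46 := fun h => hA 6 22 (by decide) (by decide) (by decide) t6 h t80
      have t3 : p 3 := by_contra fun h => hB 3 14 (by decide) (by decide) (by decide) h f26 f46
      have f88 : ¬ p 88 := fun h => hA 6 26 (by decide) (by decide) (by decide) t6 t50 h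
      have t52 : p 52 := by_contra fun h => hB 8 20 (by decide) (by decide) (by decide) f8 h f88
      have f92 : ¬ p 92 := fun h => hA 6 28 (by decide) (by decide) (by decide) t6 t52 h
      have t22 : p 22 := by_contra fun h => hB 22 4 (by decide) (by decide) (by decide) h f92 f140
      have f14 : ¬ p 14 := fun h => hA 3 2 (by decide) (by decide) (by decide) t3 h t22
      have f11 : ¬ p 11 := fun h => hA 11 6 (by decide) (by decide) (by decide) h t50 t78
      have t60 : p 60 := by_contra fun h => hB 11 16 (by decide) (by decide) (by decide) f11 h f98
      have f36 : ¬ p 36 := fun h => hA 6 12 (by decide) (by decide) (by decide) t6 h t60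
      have t56 : p 56 := by_contra fun h => hB 8 4 (by decide) (by decide) (by decide) f8 f36 h
      have f29 : ¬ p 29 := fun h => hA 1 25 (by decide) (by decide) (by decide) t1 h t56
      have t67 : p 67 := by_contra fun h => hB 11 23 (by decide) (by decide) (by decide) f11 h f112
      have f132 : ¬ p 132 := fun h => hA 1 63 (by decide) (by decide) (by decide) t1 t67 h
      have t76 : p 76 := by_contra fun h => hB 10 36 (by decide) (by decide) (by decide) f10 h f132
      have f44 : ¬ p 44 := fun h => hA 6 20 (by decide) (by decide) (by decide) t6 h t76
      have t7 : p 7 := by_contra fun h => hB 7 1 (by decide) (by decide) (by decide) h f29 f44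
      have f86 : ¬ p 86 := fun h => hA 7 22 (by decide) (by decide) (by decide) t7 t50 h
      have f144 : ¬ p 144 := fun h => hA 6 54 (by decide) (by decide) (by decide) t6 t78 h
      exact hB 14 30 (by decide) (by decide) (by decide) f14 f86 f144

theorem stmt_17 :
    (∀ χ : ℕ → Fin 2, ∃ x d : ℕ, 0 < x ∧ 0 < d ∧ 6*x + 2*d ≤ 144 ∧ χ (4*x + d) = χ x ∧ χ (6*x + 2*d) = χ x) ∧
    (∃ χ : ℕ → Fin 2, ∀ x d : ℕ, 0 < x → 0 < d → 6*x + 2*d ≤ 143 → ¬(χ (4*x + d) = χ x ∧ χ (6*x + 2*d) = χ x)) := by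
  constructor
  · intro χ
    by_contra hc
    push Not at hc
    refine core_17 (fun n => χ n = χ 1) rfl ?_ ?_
    · intro x d hx hd hn h1 h2 h3
      exact hc x d hx hd hn (h2.trans h1.symm) (h3.trans h1.symm)
    · intro x d hx hd hn h1 h2 h3
      have := hc x d hx hd hn
      omega
  · refine ⟨fun n => if n ≤ 7 ∨ (15 ≤ n ∧ n ≤ 23) ∨ (50 ≤ n ∧ n ≤ 85) then 0 else 1, ?_⟩
    intro x d hx hd hn
    dsimp only
    split_ifs <;> simp <;> omega
end

section
/- T(4,7;2) ≥ 214; that is, there exists a 2-coloring of {1, 2, ..., 213} with no positive integers x, d such that x, 4x + d, and 7x + 2d all receive the same color. -/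
theorem stmt_19 :
    (∃ χ : ℕ → Fin 2, ∀ x d : ℕ, 0 < x → 0 < d → 7*x + 2*d ≤ 213 → ¬(χ (4*x + d) = χ x ∧ χ (7*x + 2*d) = χ x)) := by
  refine ⟨fun n => if n ≤ 8 then 0 else if n ≤ 17 then 1 else if n ≤ 30 then 0
    else if n ≤ 61 then 1 else if n ≤ 115 then 0 else 1, ?_⟩
  intro x d hx hd h
  rintro ⟨h1, h2⟩
  have hx30 : x ≤ 30 := by omega
  dsimp only at h1 h2
  split_ifs at h1 <;> first | omega | (simp at h1; done) | (split_ifs at h2 <;> first | omega | (simp at h2; done))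
end
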